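/- For every real ν ≥ 0 and every integer s ≥ 1, the positive zeros of the derivatives Y′_ν and Y′_{ν+1} interlace: y′_{ν,s} < y′_{ν+1,s} < y′_{ν,s+1}. -/

import Mathlib

open Real Filter

/-- Bessel function of the first kind of real order `ν`:
`J_ν(x) = Σ_{k=0}^∞ ((−1)^k / (k! · Γ(ν+k+1))) · (x/2)^{ν+2k}`. -/
noncomputable def besselJ (ν : ℝ) (x : ℝ) : ℝ :=
  ∑' k : ℕ, ((-1 : ℝ) ^ k / ((k.factorial : ℝ) * Real.Gamma (ν + k + 1))) *
    (x / 2) ^ (ν + 2 * (k : ℝ))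

/-- Bessel function of the second kind of real order `ν`, defined as the limit
`Y_ν(x) = lim_{μ→ν, μ ∉ ℤ} (J_μ(x)·cos(μπ) − J_{−μ}(x)) / sin(μπ)`. -/
noncomputable def besselY (ν : ℝ) (x : ℝ) : ℝ :=
  limUnder (nhdsWithin ν {μ : ℝ | ∀ n : ℤ, μ ≠ (n : ℝ)})
    fun μ => (besselJ μ x * Real.cos (μ * π) - besselJ (-μ) x) / Real.sin (μ * π)

/-- `z s`, for integers `s ≥ 1`, enumerates all the positive real zeros of `f`
in strictly increasing order. -/
structure IsPosZeroSeq (f : ℝ → ℝ) (z : ℕ → ℝ) : Prop where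
  pos : ∀ s, 1 ≤ s → 0 < z s
  mono : ∀ s t, 1 ≤ s → s < t → z s < z t
  isZero : ∀ s, 1 ≤ s → f (z s) = 0
  complete : ∀ x, 0 < x → f x = 0 → ∃ s, 1 ≤ s ∧ z s = x

/-- `z s`, for integers `s ≥ 1`, enumerates the zeros `j'_{ν,s}` of `J'_ν`
(increasingly), with the convention that `x = 0` is counted as the first zero
`j'_{0,1}` of `J'_0`. -/
def IsBesselJDerivZeroSeq (ν : ℝ) (z : ℕ → ℝ) : Prop :=
  (ν = 0 → z 1 = 0 ∧ IsPosZeroSeq (deriv (besselJ 0)) fun s => z (s + 1)) ∧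
  (ν ≠ 0 → IsPosZeroSeq (deriv (besselJ ν)) z)

section BesselSeries

/-- The coefficients of the power series `∑ (-z)^k / (k! Γ(ν+k+1))`, for which
`J_ν(x) = (x/2)^ν * besselSeries ν ((x/2)^2)`. -/
noncomputable def besselCoeff (ν : ℝ) (k : ℕ) : ℝ :=
  (-1 : ℝ) ^ k / ((k.factorial : ℝ) * Real.Gamma (ν + k + 1))

/-- The entire function `∑ (-z)^k / (k! Γ(ν+k+1))`. -/
noncomputable def besselSeries (ν z : ℝ) : ℝ := ∑' k : ℕ, besselCoeff ν k * z ^ k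

theorem abs_besselCoeff_le (ν : ℝ) : ∀ᶠ k : ℕ in atTop, |besselCoeff ν k| ≤ 1 / k.factorial := by
  filter_upwards [tendsto_natCast_atTop_atTop.eventually_ge_atTop (1 - ν)] with k hk
  have h2 : (2 : ℝ) ≤ ν + k + 1 := by linarith
  have hG : 1 ≤ Real.Gamma (ν + k + 1) := by
    simpa using Real.Gamma_strictMonoOn_Ici.monotoneOn Set.self_mem_Ici h2 h2
  have hf : (0 : ℝ) < k.factorial := by positivity
  rw [besselCoeff, abs_div, abs_pow, abs_neg, abs_one, one_pow, abs_of_pos (by positivity)]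
  exact one_div_le_one_div_of_le hf (le_mul_of_one_le_right hf.le hG)

theorem summable_abs_besselCoeff (ν R : ℝ) : Summable fun k => |besselCoeff ν k| * |R| ^ k := by
  refine (Real.summable_pow_div_factorial |R|).of_norm_bounded_eventually_nat ?_
  filter_upwards [abs_besselCoeff_le ν] with k hk
  rw [Real.norm_of_nonneg (by positivity), div_eq_mul_one_div, mul_comm]
  gcongr

theorem summable_besselCoeff (ν z : ℝ) : Summable fun k => besselCoeff ν k * z ^ k :=
  Summable.of_abs (by simpa [abs_mul, abs_pow] using summable_abs_besselCoeff ν z)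

theorem besselCoeff_succ_mul (ν : ℝ) (k : ℕ) :
    besselCoeff ν (k + 1) * ((k + 1 : ℕ) : ℝ) = -besselCoeff (ν + 1) k := by
  have e : ν + ((k + 1 : ℕ) : ℝ) + 1 = ν + 1 + k + 1 := by push_cast; ring
  have hk : ((k + 1 : ℕ) : ℝ) ≠ 0 := by positivity
  have hf : (k.factorial : ℝ) ≠ 0 := by positivity
  rw [besselCoeff, besselCoeff, e, Nat.factorial_succ, Nat.cast_mul, pow_succ]
  by_cases hG : Real.Gamma (ν + 1 + k + 1) = 0
  · simp [hG]
  · field_simp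

theorem hasDerivAt_besselSeries (ν z : ℝ) :
    HasDerivAt (besselSeries ν) (-besselSeries (ν + 1) z) z := by
  have key : ∀ y, (∑' k : ℕ, besselCoeff ν k * (k * y ^ (k - 1))) = -besselSeries (ν + 1) y := by
    intro y
    rw [tsum_eq_zero_add']
    · simp only [CharP.cast_eq_zero, zero_mul, mul_zero, zero_add, Nat.add_sub_cancel,
        ← mul_assoc, besselCoeff_succ_mul, neg_mul, tsum_neg, besselSeries]
    · simp only [Nat.add_sub_cancel, ← mul_assoc, besselCoeff_succ_mul, neg_mul]
      exact (summable_besselCoeff (ν + 1) y).neg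
  rw [← key]
  have hu : Summable fun k : ℕ => |besselCoeff ν k| * (k * (|z| + 1) ^ (k - 1)) := by
    rw [← summable_nat_add_iff 1]
    have := summable_abs_besselCoeff (ν + 1) (|z| + 1)
    refine this.congr fun k => ?_
    rw [← abs_neg (besselCoeff (ν + 1) k), ← besselCoeff_succ_mul, abs_mul, Nat.abs_cast,
      abs_of_pos (by positivity : 0 < |z| + 1), Nat.add_sub_cancel, mul_assoc]
  refine hasDerivAt_tsum_of_isPreconnected (t := Metric.ball 0 (|z| + 1)) (y₀ := z) hu
    Metric.isOpen_ball (convex_ball _ _).isPreconnected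
    (fun k y _ => (hasDerivAt_pow k y).const_mul _) (fun k y hy => ?_) (by simp)
    (summable_besselCoeff ν z) (by simp)
  have hy' : |y| ≤ |z| + 1 := by simpa using (mem_ball_zero_iff.1 hy).le
  rw [Real.norm_eq_abs, abs_mul, abs_mul, abs_pow, Nat.abs_cast]
  gcongr

theorem besselCoeff_three_term {ν : ℝ} (hν : ∀ n : ℤ, ν ≠ n) (k : ℕ) :
    besselCoeff ν (k + 1) =
      (ν + 1) * besselCoeff (ν + 1) (k + 1) - besselCoeff (ν + 2) k := by
  have h0 : ν + k + 2 ≠ 0 := fun h => hν (-(k + 2)) (by push_cast; linarith)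
  have hG : Real.Gamma (ν + k + 2) ≠ 0 := Real.Gamma_ne_zero fun m h =>
    hν (-(m + k + 2)) (by push_cast; linarith)
  have e1 : ν + ((k + 1 : ℕ) : ℝ) + 1 = ν + k + 2 := by push_cast; ring
  have e2 : ν + 1 + ((k + 1 : ℕ) : ℝ) + 1 = ν + k + 2 + 1 := by push_cast; ring
  have e3 : ν + 2 + (k : ℝ) + 1 = ν + k + 2 + 1 := by ring
  have hf : (k.factorial : ℝ) ≠ 0 := by positivity
  have hk : (k : ℝ) + 1 ≠ 0 := by positivity
  simp only [besselCoeff, e1, e2, e3, Real.Gamma_add_one h0, Nat.factorial_succ, pow_succ]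
  push_cast
  field_simp
  ring

theorem besselSeries_three_term {ν : ℝ} (hν : ∀ n : ℤ, ν ≠ n) (z : ℝ) :
    besselSeries ν z = (ν + 1) * besselSeries (ν + 1) z - z * besselSeries (ν + 2) z := by
  have h0 : ν + 1 ≠ 0 := fun h => hν (-1) (by push_cast; linarith)
  have c0 : besselCoeff ν 0 = (ν + 1) * besselCoeff (ν + 1) 0 := by
    simp only [besselCoeff, CharP.cast_eq_zero, add_zero, Real.Gamma_add_one h0]
    have hG : Real.Gamma (ν + 1) ≠ 0 := Real.Gamma_ne_zero fun m h =>
      hν (-(m + 1)) (by push_cast; linarith)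
    simp
    field_simp
  have s1 := (summable_nat_add_iff 1).2 (summable_besselCoeff (ν + 1) z)
  have s2 := summable_besselCoeff (ν + 2) z
  rw [besselSeries, besselSeries, besselSeries, (summable_besselCoeff ν z).tsum_eq_zero_add,
    (summable_besselCoeff (ν + 1) z).tsum_eq_zero_add, mul_add, add_sub_assoc, ← tsum_mul_left,
    ← tsum_mul_left, ← (s1.mul_left _).tsum_sub (s2.mul_left _), c0]
  congr 1
  · ring
  · refine tsum_congr fun k => ?_
    rw [besselCoeff_three_term hν, pow_succ]
    ring

theorem besselJ_eq_rpow_mul_besselSeries (ν : ℝ) {x : ℝ} (hx : 0 < x) :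
    besselJ ν x = (x / 2) ^ ν * besselSeries ν ((x / 2) ^ 2) := by
  have h2 : 0 < x / 2 := by positivity
  rw [besselJ, besselSeries, ← tsum_mul_left]
  refine tsum_congr fun k => ?_
  rw [Real.rpow_add h2, ← Nat.cast_two, ← Nat.cast_mul, Real.rpow_natCast, pow_mul, besselCoeff]
  ring

theorem hasDerivAt_besselJ (ν : ℝ) {x : ℝ} (hx : 0 < x) :
    HasDerivAt (besselJ ν) (ν / x * besselJ ν x - besselJ (ν + 1) x) x := by
  have h2 : 0 < x / 2 := by positivity
  have hd : HasDerivAt (fun y : ℝ => y / 2) (1 / 2) x := (hasDerivAt_id x).div_const 2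
  have h := (hd.rpow_const (p := ν) (Or.inl h2.ne')).mul
    ((hasDerivAt_besselSeries ν ((x / 2) ^ 2)).comp x (hd.pow 2))
  have heq : besselJ ν =ᶠ[nhds x]
      ((fun y : ℝ => (y / 2) ^ ν) * (besselSeries ν ∘ ((fun y : ℝ => y / 2) ^ 2))) := by
    filter_upwards [lt_mem_nhds hx] with y hy
    exact besselJ_eq_rpow_mul_besselSeries ν hy
  refine (h.congr_of_eventuallyEq heq).congr_deriv ?_
  rw [besselJ_eq_rpow_mul_besselSeries ν hx, besselJ_eq_rpow_mul_besselSeries (ν + 1) hx,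
    Real.rpow_sub h2, Real.rpow_add h2, Real.rpow_one]
  simp
  field_simp
  ring

theorem besselJ_three_term {ν : ℝ} (hν : ∀ n : ℤ, ν ≠ n) {x : ℝ} (hx : 0 < x) :
    besselJ ν x = 2 * (ν + 1) / x * besselJ (ν + 1) x - besselJ (ν + 2) x := by
  have h2 : 0 < x / 2 := by positivity
  rw [besselJ_eq_rpow_mul_besselSeries ν hx, besselJ_eq_rpow_mul_besselSeries (ν + 1) hx,
    besselJ_eq_rpow_mul_besselSeries (ν + 2) hx, besselSeries_three_term hν,
    Real.rpow_add h2, Real.rpow_add h2, Real.rpow_one, Real.rpow_two]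
  field_simp

theorem tendsto_rpow_neg_mul_besselJ (ν : ℝ) :
    Tendsto (fun x => (x / 2) ^ (-ν) * besselJ ν x) (nhdsWithin 0 (Set.Ioi 0))
      (nhds (1 / Real.Gamma (ν + 1))) := by
  have hc : Continuous (besselSeries ν) :=
    continuous_iff_continuousAt.2 fun z => (hasDerivAt_besselSeries ν z).continuousAt
  have h0 : besselSeries ν ((0 / 2) ^ 2) = 1 / Real.Gamma (ν + 1) := by
    rw [besselSeries, tsum_eq_single 0 (fun k hk => by simp [hk])]
    simp [besselCoeff]
  have hc2 : Continuous fun x : ℝ => besselSeries ν ((x / 2) ^ 2) := by fun_prop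
  rw [← h0]
  refine ((hc2.tendsto 0).mono_left nhdsWithin_le_nhds).congr' ?_
  filter_upwards [self_mem_nhdsWithin] with x hx
  have h2 : 0 < x / 2 := half_pos hx
  rw [besselJ_eq_rpow_mul_besselSeries ν hx, ← mul_assoc, ← Real.rpow_add h2]
  simp

end BesselSeries

section SchlafliIntegrals

open MeasureTheory

/-- The finite part of the Schläfli integrals, with a phase `φ`. -/
noncomputable def schlafliCos (φ ν x : ℝ) : ℝ :=
  ∫ θ in (0 : ℝ)..π, Real.cos (ν * θ - x * Real.sin θ + φ)

/-- The infinite part of the Schläfli integrals. -/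
noncomputable def schlafliExp (ν x : ℝ) : ℝ :=
  ∫ t in Set.Ioi (0 : ℝ), Real.exp (-ν * t - x * Real.sinh t)

theorem abs_schlafliCos_le (φ ν x : ℝ) : |schlafliCos φ ν x| ≤ π := by
  have := intervalIntegral.norm_integral_le_of_norm_le_const (a := 0) (b := π) (C := 1)
    (f := fun θ => Real.cos (ν * θ - x * Real.sin θ + φ)) (fun θ _ => Real.abs_cos_le_one _)
  simpa [schlafliCos, abs_of_pos Real.pi_pos] using this

theorem continuous_schlafliCos (φ x : ℝ) : Continuous fun ν => schlafliCos φ ν x := by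
  unfold schlafliCos
  fun_prop

theorem hasDerivAt_schlafliCos_integral (φ ν x : ℝ) :
    HasDerivAt (schlafliCos φ ν)
      (∫ θ in (0 : ℝ)..π, Real.sin θ * Real.sin (ν * θ - x * Real.sin θ + φ)) x := by
  refine (intervalIntegral.hasDerivAt_integral_of_dominated_loc_of_deriv_le
    (a := 0) (b := π) (μ := volume) (F := fun x θ => Real.cos (ν * θ - x * Real.sin θ + φ))
    (F' := fun x θ => Real.sin θ * Real.sin (ν * θ - x * Real.sin θ + φ)) (bound := fun _ => 1)
    Filter.univ_mem ?_ ?_ ?_ ?_ ?_ ?_).2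
  · exact Eventually.of_forall fun y => (by fun_prop : Continuous _).aestronglyMeasurable
  · exact (by fun_prop : Continuous _).intervalIntegrable _ _
  · exact (by fun_prop : Continuous _).aestronglyMeasurable
  · refine Eventually.of_forall fun θ _ y _ => ?_
    rw [Real.norm_eq_abs, abs_mul]
    exact mul_le_one₀ (Real.abs_sin_le_one _) (abs_nonneg _) (Real.abs_sin_le_one _)
  · exact intervalIntegrable_const
  · refine Eventually.of_forall fun θ _ y _ => ?_
    have h : HasDerivAt (fun y : ℝ => ν * θ - y * Real.sin θ + φ) (-(1 * Real.sin θ)) y :=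
      (((hasDerivAt_id y).mul_const _).const_sub _).add_const _
    exact h.cos.congr_deriv (by ring)

theorem hasDerivAt_schlafliCos (φ ν x : ℝ) :
    HasDerivAt (schlafliCos φ ν) ((schlafliCos φ (ν - 1) x - schlafliCos φ (ν + 1) x) / 2) x := by
  refine (hasDerivAt_schlafliCos_integral φ ν x).congr_deriv ?_
  rw [schlafliCos, schlafliCos, ← intervalIntegral.integral_sub, ← intervalIntegral.integral_div]
  · refine intervalIntegral.integral_congr fun θ _ => ?_
    have e1 : (ν - 1) * θ - x * Real.sin θ + φ = (ν * θ - x * Real.sin θ + φ) - θ := by ring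
    have e2 : (ν + 1) * θ - x * Real.sin θ + φ = (ν * θ - x * Real.sin θ + φ) + θ := by ring
    simp only [e1, e2, Real.cos_sub, Real.cos_add]
    ring
  all_goals exact (by fun_prop : Continuous _).intervalIntegrable _ _

theorem schlafliCos_three_term (φ ν x : ℝ) :
    ν * schlafliCos φ ν x - x / 2 * (schlafliCos φ (ν - 1) x + schlafliCos φ (ν + 1) x) =
      Real.sin (ν * π + φ) - Real.sin φ := by
  have h : ∀ θ ∈ Set.uIcc 0 π, HasDerivAt (fun θ : ℝ => Real.sin (ν * θ - x * Real.sin θ + φ))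
      (Real.cos (ν * θ - x * Real.sin θ + φ) * (ν * 1 - x * Real.cos θ)) θ := fun θ _ =>
    ((((hasDerivAt_id θ).const_mul ν).sub ((Real.hasDerivAt_sin θ).const_mul x)).add_const φ).sin
  have h2 := intervalIntegral.integral_eq_sub_of_hasDerivAt h
    ((by fun_prop : Continuous _).intervalIntegrable _ _)
  simp only [Real.sin_pi, mul_zero, sub_zero, Real.sin_zero, zero_add] at h2
  rw [← h2, schlafliCos, schlafliCos, schlafliCos, ← intervalIntegral.integral_add,
    ← intervalIntegral.integral_const_mul, ← intervalIntegral.integral_const_mul,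
    ← intervalIntegral.integral_sub]
  · refine intervalIntegral.integral_congr fun θ _ => ?_
    have e1 : (ν - 1) * θ - x * Real.sin θ + φ = (ν * θ - x * Real.sin θ + φ) - θ := by ring
    have e2 : (ν + 1) * θ - x * Real.sin θ + φ = (ν * θ - x * Real.sin θ + φ) + θ := by ring
    simp only [e1, e2, Real.cos_sub, Real.cos_add]
    ring
  all_goals exact (by fun_prop : Continuous _).intervalIntegrable _ _

theorem exp_mul_sub_mul_sinh_le {a M x c t : ℝ} (ha : |a| ≤ M) (hc : 0 < c) (hx : c ≤ x)
    (ht : 0 ≤ t) :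
    Real.exp (a * t - x * Real.sinh t) ≤ Real.exp ((M + 1) ^ 2 / c) * Real.exp (-t) := by
  have hs : t ^ 2 / 4 ≤ Real.sinh t := by
    rw [Real.sinh_eq]
    have h1 := Real.quadratic_le_exp_of_nonneg ht
    have h2 : Real.exp (-t) ≤ 1 := Real.exp_le_one_iff.2 (by linarith)
    linarith
  rw [← Real.exp_add]
  refine Real.exp_le_exp.2 ?_
  have h1 : a * t ≤ M * t := by gcongr; exact (le_abs_self a).trans ha
  have h2 : c * (t ^ 2 / 4) ≤ x * Real.sinh t := by gcongr; exact hc.le.trans hx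
  have h3 : (M + 1) * t ≤ (M + 1) ^ 2 / c + c * (t ^ 2 / 4) := by
    have : (M + 1) ^ 2 / c + c * (t ^ 2 / 4) - (M + 1) * t = ((M + 1) - c * t / 2) ^ 2 / c := by
      field_simp
      ring
    have h4 : 0 ≤ ((M + 1) - c * t / 2) ^ 2 / c := by positivity
    linarith
  linarith

theorem integrableOn_const_mul_exp_neg (C : ℝ) :
    IntegrableOn (fun t => C * Real.exp (-t)) (Set.Ioi 0) := by
  have := integrableOn_exp_neg_Ioi (0 : ℝ)
  exact this.const_mul C

theorem integrableOn_exp_mul_sub_mul_sinh (a : ℝ) {x : ℝ} (hx : 0 < x) :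
    IntegrableOn (fun t => Real.exp (a * t - x * Real.sinh t)) (Set.Ioi 0) := by
  refine (integrableOn_const_mul_exp_neg (Real.exp ((|a| + 1) ^ 2 / x))).mono'
    (by fun_prop : Continuous _).aestronglyMeasurable ?_
  filter_upwards [ae_restrict_mem measurableSet_Ioi] with t ht
  rw [Real.norm_of_nonneg (Real.exp_pos _).le]
  exact exp_mul_sub_mul_sinh_le le_rfl hx le_rfl (le_of_lt ht)

theorem continuous_schlafliExp {x : ℝ} (hx : 0 < x) : Continuous fun ν => schlafliExp ν x := by
  refine continuous_iff_continuousAt.2 fun ν => ?_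
  refine continuousAt_of_dominated
    (bound := fun t => Real.exp ((|ν| + 1 + 1) ^ 2 / x) * Real.exp (-t)) ?_ ?_
    (integrableOn_const_mul_exp_neg _) ?_
  · exact Eventually.of_forall fun y => (by fun_prop : Continuous _).aestronglyMeasurable
  · filter_upwards [Metric.ball_mem_nhds ν one_pos] with μ hμ
    filter_upwards [ae_restrict_mem measurableSet_Ioi] with t ht
    rw [Real.norm_of_nonneg (Real.exp_pos _).le]
    refine exp_mul_sub_mul_sinh_le ?_ hx le_rfl (le_of_lt ht)
    have h1 : |μ - ν| < 1 := by simpa [Real.dist_eq] using hμ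
    have h2 := abs_sub_abs_le_abs_sub μ ν
    rw [abs_neg]
    linarith
  · exact Eventually.of_forall fun t => by fun_prop

theorem hasDerivAt_schlafliExp_integral (ν : ℝ) {x : ℝ} (hx : 0 < x) :
    IntegrableOn (fun t => -Real.sinh t * Real.exp (-ν * t - x * Real.sinh t)) (Set.Ioi 0) ∧
    HasDerivAt (schlafliExp ν)
      (∫ t in Set.Ioi (0 : ℝ), -Real.sinh t * Real.exp (-ν * t - x * Real.sinh t)) x := by
  refine hasDerivAt_integral_of_dominated_loc_of_deriv_le
    (F := fun x t => Real.exp (-ν * t - x * Real.sinh t))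
    (F' := fun x t => -Real.sinh t * Real.exp (-ν * t - x * Real.sinh t))
    (bound := fun t => Real.exp ((|ν| + 1 + 1) ^ 2 / (x / 2)) * Real.exp (-t))
    (Ioi_mem_nhds (half_lt_self hx)) ?_ ?_ ?_ ?_ (integrableOn_const_mul_exp_neg _) ?_
  · exact Eventually.of_forall fun y => (by fun_prop : Continuous _).aestronglyMeasurable
  · exact integrableOn_exp_mul_sub_mul_sinh _ hx
  · exact (by fun_prop : Continuous _).aestronglyMeasurable
  · filter_upwards [ae_restrict_mem measurableSet_Ioi] with t ht y hy
    have hs : 0 ≤ Real.sinh t := Real.sinh_nonneg_iff.2 (le_of_lt ht)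
    have hs' : Real.sinh t ≤ Real.exp t := by
      rw [Real.sinh_eq]
      linarith [Real.exp_pos t, Real.exp_pos (-t)]
    rw [norm_mul, norm_neg, Real.norm_of_nonneg hs, Real.norm_of_nonneg (Real.exp_pos _).le]
    calc Real.sinh t * Real.exp (-ν * t - y * Real.sinh t)
        ≤ Real.exp t * Real.exp (-ν * t - y * Real.sinh t) := by gcongr
      _ = Real.exp ((1 - ν) * t - y * Real.sinh t) := by rw [← Real.exp_add]; ring_nf
      _ ≤ _ := exp_mul_sub_mul_sinh_le ?_ (half_pos hx) (le_of_lt hy) (le_of_lt ht)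
    have := abs_sub 1 ν
    rw [abs_one] at this
    linarith
  · refine Eventually.of_forall fun t y _ => ?_
    have h : HasDerivAt (fun y : ℝ => -ν * t - y * Real.sinh t) (-(1 * Real.sinh t)) y :=
      ((hasDerivAt_id y).mul_const _).const_sub _
    exact h.exp.congr_deriv (by ring)

theorem exp_shift_sub (ν x t : ℝ) : Real.exp (-(ν - 1) * t - x * Real.sinh t) =
    (Real.cosh t + Real.sinh t) * Real.exp (-ν * t - x * Real.sinh t) := by
  rw [Real.cosh_add_sinh, ← Real.exp_add]
  ring_nf

theorem exp_shift_add (ν x t : ℝ) : Real.exp (-(ν + 1) * t - x * Real.sinh t) =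
    (Real.cosh t - Real.sinh t) * Real.exp (-ν * t - x * Real.sinh t) := by
  rw [Real.cosh_sub_sinh, ← Real.exp_add]
  ring_nf

theorem hasDerivAt_schlafliExp (ν : ℝ) {x : ℝ} (hx : 0 < x) :
    HasDerivAt (schlafliExp ν) ((schlafliExp (ν + 1) x - schlafliExp (ν - 1) x) / 2) x := by
  refine (hasDerivAt_schlafliExp_integral ν hx).2.congr_deriv ?_
  rw [schlafliExp, schlafliExp, ← integral_sub (integrableOn_exp_mul_sub_mul_sinh _ hx)
    (integrableOn_exp_mul_sub_mul_sinh _ hx), ← integral_div]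
  refine integral_congr_ae (Eventually.of_forall fun t => ?_)
  simp only [exp_shift_sub, exp_shift_add]
  ring

theorem schlafliExp_three_term (ν : ℝ) {x : ℝ} (hx : 0 < x) :
    ν * schlafliExp ν x + x / 2 * (schlafliExp (ν - 1) x + schlafliExp (ν + 1) x) = 1 := by
  have i0 := integrableOn_exp_mul_sub_mul_sinh (-ν) hx
  have i1 := integrableOn_exp_mul_sub_mul_sinh (-(ν - 1)) hx
  have i2 := integrableOn_exp_mul_sub_mul_sinh (-(ν + 1)) hx
  have i12 : IntegrableOn (fun t => x / 2 * (Real.exp (-(ν - 1) * t - x * Real.sinh t) +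
      Real.exp (-(ν + 1) * t - x * Real.sinh t))) (Set.Ioi 0) := (i1.add i2).const_mul (x / 2)
  have hd : ∀ t ∈ Set.Ici (0 : ℝ), HasDerivAt (fun t => -Real.exp (-ν * t - x * Real.sinh t))
      (ν * Real.exp (-ν * t - x * Real.sinh t) +
        x / 2 * (Real.exp (-(ν - 1) * t - x * Real.sinh t) +
          Real.exp (-(ν + 1) * t - x * Real.sinh t))) t := fun t _ => by
    have h : HasDerivAt (fun t : ℝ => -ν * t - x * Real.sinh t) (-ν * 1 - x * Real.cosh t) t :=
      ((hasDerivAt_id t).const_mul _).sub ((Real.hasDerivAt_sinh t).const_mul x)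
    refine h.exp.neg.congr_deriv ?_
    rw [exp_shift_sub, exp_shift_add]
    ring
  have hlim : Tendsto (fun t => -Real.exp (-ν * t - x * Real.sinh t)) atTop (nhds 0) := by
    rw [← neg_zero]
    refine Tendsto.neg ?_
    have hb : Tendsto (fun t => Real.exp ((|ν| + 1) ^ 2 / x) * Real.exp (-t)) atTop (nhds 0) := by
      simpa using (Real.tendsto_exp_neg_atTop_nhds_zero).const_mul (Real.exp ((|ν| + 1) ^ 2 / x))
    refine squeeze_zero' (Eventually.of_forall fun t => (Real.exp_pos _).le) ?_ hb
    filter_upwards [eventually_ge_atTop 0] with t ht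
    exact exp_mul_sub_mul_sinh_le (abs_neg ν).le hx le_rfl ht
  have := integral_Ioi_of_hasDerivAt_of_tendsto' hd ((i0.const_mul ν).add i12) hlim
  rw [integral_add (i0.const_mul ν) i12, integral_const_mul,
    integral_const_mul, integral_add i1 i2] at this
  simpa [schlafliExp] using this

end SchlafliIntegrals

section BesselRecurrence

/-- The recurrences shared by all families of cylinder functions. -/
structure BesselRecurrence (f : ℝ → ℝ → ℝ) : Prop where
  deriv_eq : ∀ ν x, 0 < x → HasDerivAt (f ν) ((f (ν - 1) x - f (ν + 1) x) / 2) x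
  three_term : ∀ ν x, 0 < x → ν * f ν x = x / 2 * (f (ν - 1) x + f (ν + 1) x)

namespace BesselRecurrence

variable {f : ℝ → ℝ → ℝ}

theorem hasDerivAt (hf : BesselRecurrence f) (ν : ℝ) {x : ℝ} (hx : 0 < x) :
    HasDerivAt (f ν) (ν / x * f ν x - f (ν + 1) x) x := by
  refine (hf.deriv_eq ν x hx).congr_deriv ?_
  have := hf.three_term ν x hx
  field_simp
  linarith

theorem hasDerivAt_succ (hf : BesselRecurrence f) (ν : ℝ) {x : ℝ} (hx : 0 < x) :
    HasDerivAt (f (ν + 1)) (f ν x - (ν + 1) / x * f (ν + 1) x) x := by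
  refine (hf.deriv_eq (ν + 1) x hx).congr_deriv ?_
  have := hf.three_term (ν + 1) x hx
  rw [add_sub_cancel_right] at *
  field_simp
  linarith

theorem eq_sub (hf : BesselRecurrence f) (ν : ℝ) {x : ℝ} (hx : 0 < x) :
    f ν x = 2 * (ν + 1) / x * f (ν + 1) x - f (ν + 2) x := by
  have := hf.three_term (ν + 1) x hx
  rw [add_sub_cancel_right, add_assoc, one_add_one_eq_two] at this
  field_simp
  linarith

end BesselRecurrence

/-- The right-hand side of Schläfli's integral for `J_ν`. -/
noncomputable def schlafliJ (ν x : ℝ) : ℝ :=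
  (schlafliCos 0 ν x - Real.sin (ν * π) * schlafliExp ν x) / π

/-- The right-hand side of Schläfli's integral for `Y_ν`. -/
noncomputable def schlafliY (ν x : ℝ) : ℝ :=
  (schlafliCos (π / 2) ν x - schlafliExp (-ν) x - Real.cos (ν * π) * schlafliExp ν x) / π

theorem besselRecurrence_schlafliJ : BesselRecurrence schlafliJ where
  deriv_eq ν x hx := by
    have h := ((hasDerivAt_schlafliCos 0 ν x).sub
      ((hasDerivAt_schlafliExp ν hx).const_mul (Real.sin (ν * π)))).div_const π
    refine h.congr_deriv ?_
    simp only [schlafliJ, sub_mul, add_mul, one_mul, Real.sin_sub_pi, Real.sin_add_pi]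
    ring
  three_term ν x hx := by
    have h1 := schlafliCos_three_term 0 ν x
    have h2 := schlafliExp_three_term ν hx
    simp only [schlafliJ, sub_mul, add_mul, one_mul, Real.sin_sub_pi, Real.sin_add_pi]
    rw [add_zero, Real.sin_zero] at h1
    field_simp
    linear_combination 2 * h1 - 2 * Real.sin (ν * π) * h2

theorem besselRecurrence_schlafliY : BesselRecurrence schlafliY where
  deriv_eq ν x hx := by
    have hn : HasDerivAt (schlafliExp (-ν))
      ((schlafliExp (-ν + 1) x - schlafliExp (-ν - 1) x) / 2) x := hasDerivAt_schlafliExp (-ν) hx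
    have h := (((hasDerivAt_schlafliCos (π / 2) ν x).sub hn).sub
      ((hasDerivAt_schlafliExp ν hx).const_mul (Real.cos (ν * π)))).div_const π
    refine h.congr_deriv ?_
    have e1 : -(ν - 1) = -ν + 1 := by ring
    have e2 : -(ν + 1) = -ν - 1 := by ring
    simp only [schlafliY, e1, e2, sub_mul, add_mul, one_mul, Real.cos_sub_pi, Real.cos_add_pi]
    ring
  three_term ν x hx := by
    have h1 := schlafliCos_three_term (π / 2) ν x
    have h2 := schlafliExp_three_term ν hx
    have h3 := schlafliExp_three_term (-ν) hx
    have e1 : -(ν - 1) = -ν + 1 := by ring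
    have e2 : -(ν + 1) = -ν - 1 := by ring
    simp only [schlafliY, e1, e2, sub_mul, add_mul, one_mul, Real.cos_sub_pi, Real.cos_add_pi]
    rw [Real.sin_add_pi_div_two, Real.sin_pi_div_two] at h1
    field_simp
    linear_combination 2 * h1 - 2 * Real.cos (ν * π) * h2 + 2 * h3

end BesselRecurrence

section SchlafliJ

open MeasureTheory

theorem eq_zero_of_recurrence_of_tendsto_zero {ν : ℝ} (h1 : -1 < ν) (h2 : ν < 0) {f g : ℝ → ℝ}
    (hf : ∀ x, 0 < x → HasDerivAt f (ν / x * f x - g x) x)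
    (hg : ∀ x, 0 < x → HasDerivAt g (f x - (ν + 1) / x * g x) x)
    (hf0 : Tendsto (fun x => (x / 2) ^ (-ν) * f x) (nhdsWithin 0 (Set.Ioi 0)) (nhds 0))
    (hg0 : Tendsto (fun x => (x / 2) ^ (ν + 1) * g x) (nhdsWithin 0 (Set.Ioi 0)) (nhds 0))
    {x : ℝ} (hx : 0 < x) : f x = 0 ∧ g x = 0 := by
  set P : ℝ → ℝ := fun x => (x / 2) ^ (-ν) * f x with hP
  set Q : ℝ → ℝ := fun x => (x / 2) ^ (ν + 1) * g x with hQ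
  set K : ℝ → ℝ := fun x =>
    2 * ((x / 2) ^ (2 * ν + 2) / (2 * ν + 2) + (x / 2) ^ (-2 * ν) / (-2 * ν)) with hK
  have hpow : ∀ p y : ℝ, 0 < y →
      HasDerivAt (fun y : ℝ => (y / 2) ^ p) (p / 2 * (y / 2) ^ (p - 1)) y := fun p y hy =>
    (((hasDerivAt_id y).div_const 2).rpow_const (p := p)
      (Or.inl (half_pos hy).ne')).congr_deriv (by simp only [id_eq]; ring)
  have hK' : ∀ y, 0 < y → HasDerivAt K ((y / 2) ^ (2 * ν + 1) + (y / 2) ^ (-2 * ν - 1)) y := by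
    intro y hy
    refine ((((hpow (2 * ν + 2) y hy).div_const (2 * ν + 2)).add
      ((hpow (-2 * ν) y hy).div_const (-2 * ν))).const_mul 2).congr_deriv ?_
    have e : 2 * ν + 2 - 1 = 2 * ν + 1 := by ring
    have n1 : 2 * ν + 2 ≠ 0 := by linarith
    have n3 : ν + 1 ≠ 0 := by linarith
    have n2 : ν ≠ 0 := h2.ne
    rw [e]
    field_simp
  have hP' : ∀ y, 0 < y → HasDerivAt P (-(y / 2) ^ (-2 * ν - 1) * Q y) y := by
    intro y hy
    refine ((hpow (-ν) y hy).mul (hf y hy)).congr_deriv ?_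
    have h0 := half_pos hy
    have e1 : (y / 2) ^ (-2 * ν - 1) * (y / 2) ^ (ν + 1) = (y / 2) ^ (-ν) := by
      rw [← Real.rpow_add h0]; ring_nf
    have e2 : (y / 2) ^ (-ν - 1) = (y / 2) ^ (-ν) / (y / 2) := by rw [Real.rpow_sub_one h0.ne']
    simp only [hQ]
    rw [neg_mul, ← mul_assoc, e1, e2]
    field_simp
    ring
  have hQ' : ∀ y, 0 < y → HasDerivAt Q ((y / 2) ^ (2 * ν + 1) * P y) y := by
    intro y hy
    refine ((hpow (ν + 1) y hy).mul (hg y hy)).congr_deriv ?_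
    have h0 := half_pos hy
    have e1 : (y / 2) ^ (2 * ν + 1) * (y / 2) ^ (-ν) = (y / 2) ^ (ν + 1) := by
      rw [← Real.rpow_add h0]; ring_nf
    have e2 : (y / 2) ^ (ν + 1 - 1) = (y / 2) ^ (ν + 1) / (y / 2) := by
      rw [Real.rpow_sub_one h0.ne']
    simp only [hP]
    rw [← mul_assoc, e1, e2]
    field_simp
    ring
  set G : ℝ → ℝ := fun y => (P y ^ 2 + Q y ^ 2) * Real.exp (-K y) with hG
  have hG' : ∀ y, 0 < y → HasDerivAt G
      ((2 * P y * (-(y / 2) ^ (-2 * ν - 1) * Q y) + 2 * Q y * ((y / 2) ^ (2 * ν + 1) * P y) -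
        (P y ^ 2 + Q y ^ 2) * ((y / 2) ^ (2 * ν + 1) + (y / 2) ^ (-2 * ν - 1))) *
          Real.exp (-K y)) y := by
    intro y hy
    refine ((((hP' y hy).pow 2).add ((hQ' y hy).pow 2)).mul (hK' y hy).neg.exp).congr_deriv ?_
    simp
    ring
  have hanti : AntitoneOn G (Set.Ioi 0) := by
    refine antitoneOn_of_deriv_nonpos (convex_Ioi 0)
      (fun y hy => (hG' y hy).continuousAt.continuousWithinAt)
      (fun y hy => ?_) (fun y hy => ?_) <;> rw [interior_Ioi] at hy
    · exact (hG' y hy).differentiableAt.differentiableWithinAt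
    · rw [(hG' y hy).deriv]
      refine mul_nonpos_of_nonpos_of_nonneg ?_ (Real.exp_pos _).le
      have r1 : 0 < (y / 2) ^ (-2 * ν - 1) := Real.rpow_pos_of_pos (half_pos hy) _
      have r2 : 0 < (y / 2) ^ (2 * ν + 1) := Real.rpow_pos_of_pos (half_pos hy) _
      nlinarith [mul_nonneg r1.le (sq_nonneg (P y + Q y)), mul_nonneg r2.le (sq_nonneg (P y - Q y))]
  have hlim : Tendsto G (nhdsWithin 0 (Set.Ioi 0)) (nhds 0) := by
    have : Tendsto (fun y => P y ^ 2 + Q y ^ 2) (nhdsWithin 0 (Set.Ioi 0)) (nhds 0) := by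
      simpa using (hf0.pow 2).add (hg0.pow 2)
    refine squeeze_zero' (Eventually.of_forall fun y => by positivity) ?_ this
    filter_upwards [self_mem_nhdsWithin] with y hy
    refine mul_le_of_le_one_right (by positivity) (Real.exp_le_one_iff.2 ?_)
    have h0 := half_pos (show 0 < y from hy)
    have : 0 ≤ K y := by
      have n1 : 0 < 2 * ν + 2 := by linarith
      have n2 : 0 < -2 * ν := by linarith
      positivity
    linarith
  have hGx : G x ≤ 0 := by
    refine ge_of_tendsto hlim ?_
    filter_upwards [Ioo_mem_nhdsGT hx] with y hy
    exact hanti hy.1 hx hy.2.le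
  have hpos := Real.exp_pos (-K x)
  have hsum : P x ^ 2 + Q x ^ 2 ≤ 0 := by
    by_contra! h
    exact absurd hGx (not_le.2 (mul_pos h hpos))
  have hP0 : P x = 0 := by nlinarith [sq_nonneg (P x), sq_nonneg (Q x)]
  have hQ0 : Q x = 0 := by nlinarith [sq_nonneg (P x), sq_nonneg (Q x)]
  have hr := fun p => (Real.rpow_pos_of_pos (half_pos hx) p).ne'
  exact ⟨(mul_eq_zero.1 hP0).resolve_left (hr _), (mul_eq_zero.1 hQ0).resolve_left (hr _)⟩

theorem integrableOn_exp_mul_sub_mul_exp (a : ℝ) {y : ℝ} (hy : 0 < y) :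
    IntegrableOn (fun t => Real.exp (a * t - y * Real.exp t)) (Set.Ioi 0) := by
  refine (integrableOn_exp_mul_sub_mul_sinh a hy).mono'
    (by fun_prop : Continuous _).aestronglyMeasurable (Eventually.of_forall fun t => ?_)
  rw [Real.norm_of_nonneg (Real.exp_pos _).le]
  have : Real.sinh t ≤ Real.exp t := by
    rw [Real.sinh_eq]
    linarith [Real.exp_pos t, Real.exp_pos (-t)]
  gcongr

theorem setIntegral_exp_mul_exp_neg_exp {a : ℝ} (ha : 0 < a) {y : ℝ} (hy : 0 < y) :
    y ^ a * ∫ t in Set.Ioi (0 : ℝ), Real.exp (a * t - y * Real.exp t) =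
      ∫ s in Set.Ioi y, Real.exp (-s) * s ^ (a - 1) := by
  have hcomp : ∀ t, Real.exp (-(y * Real.exp t)) * (y * Real.exp t) ^ (a - 1) *
      (y * Real.exp t) = y ^ a * Real.exp (a * t - y * Real.exp t) := fun t => by
    have : Real.exp (t * (a - 1)) = Real.exp (a * t) / Real.exp t := by
      rw [← Real.exp_sub]; ring_nf
    rw [Real.mul_rpow hy.le (Real.exp_pos t).le, ← Real.exp_mul, sub_eq_add_neg (a * t),
      Real.exp_add, Real.rpow_sub_one hy.ne', this]
    field_simp
  have himg : (fun t => y * Real.exp t) '' Set.Ici 0 ⊆ Set.Ioi 0 := by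
    rintro _ ⟨t, -, rfl⟩
    exact mul_pos hy (Real.exp_pos t)
  have h := integral_comp_mul_deriv_Ioi (f := fun t => y * Real.exp t)
    (f' := fun t => y * Real.exp t) (g := fun s => Real.exp (-s) * s ^ (a - 1)) (a := 0)
    (by fun_prop) (Real.tendsto_exp_atTop.const_mul_atTop hy)
    (fun t _ => ((Real.hasDerivAt_exp t).const_mul y).hasDerivWithinAt) ?_
    ((Real.GammaIntegral_convergent ha).mono_set himg) ?_
  · simp only [Function.comp_apply, Real.exp_zero, mul_one, hcomp] at h
    rw [← h, ← integral_const_mul]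
  · intro s hs
    have hs0 : 0 < s := himg (Set.image_mono Set.Ioi_subset_Ici_self hs)
    exact ((by fun_prop : Continuous fun s : ℝ => Real.exp (-s)).continuousAt.mul
      (Real.continuousAt_rpow_const s _ (Or.inl hs0.ne'))).continuousWithinAt
  · simp only [Function.comp_apply, hcomp]
    rw [integrableOn_Ici_iff_integrableOn_Ioi]
    exact (integrableOn_exp_mul_sub_mul_exp a hy).const_mul _

theorem tendsto_rpow_mul_schlafliExp {a : ℝ} (ha : 0 < a) :
    Tendsto (fun x => (x / 2) ^ a * schlafliExp (-a) x) (nhdsWithin 0 (Set.Ioi 0))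
      (nhds (Real.Gamma a)) := by
  have hL : Tendsto (fun x : ℝ => ∫ s in Set.Ioi (x / 2), Real.exp (-s) * s ^ (a - 1))
      (nhdsWithin 0 (Set.Ioi 0)) (nhds (Real.Gamma a)) := by
    rw [Real.Gamma_eq_integral ha]
    have hi := Real.GammaIntegral_convergent ha
    have hc : Tendsto (fun x : ℝ => ∫ s in Set.Ioi 0, (Set.Ioi (x / 2)).indicator
        (fun s => Real.exp (-s) * s ^ (a - 1)) s) (nhdsWithin 0 (Set.Ioi 0))
        (nhds (∫ s in Set.Ioi 0, Real.exp (-s) * s ^ (a - 1))) := by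
      refine tendsto_integral_filter_of_dominated_convergence _
        (Eventually.of_forall fun x => hi.aestronglyMeasurable.indicator measurableSet_Ioi)
        (Eventually.of_forall fun x => Eventually.of_forall fun s =>
          norm_indicator_le_norm_self _ _) hi.norm ?_
      filter_upwards [ae_restrict_mem measurableSet_Ioi] with s hs
      refine tendsto_const_nhds.congr' ?_
      filter_upwards [Ioo_mem_nhdsGT (show (0 : ℝ) < s from hs)] with x hx
      rw [Set.indicator_of_mem]
      have := hx.1
      have := hx.2
      rw [Set.mem_Ioi]
      linarith
    refine hc.congr' ?_
    filter_upwards [self_mem_nhdsWithin] with x hx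
    rw [setIntegral_indicator measurableSet_Ioi, Set.inter_eq_right.2
      (Set.Ioi_subset_Ioi (half_pos (show 0 < x from hx)).le)]
  have hU : Tendsto (fun x : ℝ => Real.exp (x / 2) *
      ∫ s in Set.Ioi (x / 2), Real.exp (-s) * s ^ (a - 1))
      (nhdsWithin 0 (Set.Ioi 0)) (nhds (Real.Gamma a)) := by
    have h1 : Tendsto (fun x : ℝ => Real.exp (x / 2)) (nhdsWithin 0 (Set.Ioi 0)) (nhds 1) := by
      have : Continuous fun x : ℝ => Real.exp (x / 2) := by fun_prop
      simpa using (this.tendsto 0).mono_left nhdsWithin_le_nhds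
    simpa using h1.mul hL
  refine tendsto_of_tendsto_of_tendsto_of_le_of_le' hL hU ?_ ?_
  all_goals
    filter_upwards [self_mem_nhdsWithin] with x hx
    have h0 : 0 < x / 2 := half_pos hx
    have i1 := integrableOn_exp_mul_sub_mul_exp a h0
    have i2 := integrableOn_exp_mul_sub_mul_sinh a hx
    have hr := Real.rpow_nonneg h0.le a
    rw [← setIntegral_exp_mul_exp_neg_exp ha h0, schlafliExp]
    simp only [neg_neg]
  · refine mul_le_mul_of_nonneg_left (setIntegral_mono i1 i2 fun t => Real.exp_le_exp.2 ?_) hr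
    rw [Real.sinh_eq]
    nlinarith [Real.exp_pos (-t)]
  · rw [mul_left_comm]
    refine mul_le_mul_of_nonneg_left ?_ hr
    rw [← integral_const_mul]
    refine setIntegral_mono_on i2 (i1.const_mul _) measurableSet_Ioi fun t ht => ?_
    rw [← Real.exp_add, Real.sinh_eq]
    have : Real.exp (-t) ≤ 1 := Real.exp_le_one_iff.2 (neg_nonpos.2 (le_of_lt ht))
    refine Real.exp_le_exp.2 ?_
    nlinarith

theorem tendsto_half_rpow_nhdsGT_zero {a : ℝ} (ha : 0 < a) :
    Tendsto (fun x : ℝ => (x / 2) ^ a) (nhdsWithin 0 (Set.Ioi 0)) (nhds 0) := by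
  have : Continuous fun x : ℝ => (x / 2) ^ a :=
    (continuous_id.div_const 2).rpow_const fun _ => Or.inr ha.le
  have h := (this.tendsto 0).mono_left (nhdsWithin_le_nhds (s := Set.Ioi 0))
  simpa [Real.zero_rpow ha.ne'] using h

theorem tendsto_rpow_neg_mul_schlafliJ {ν : ℝ} (h1 : -1 < ν) (h2 : ν < 0) :
    Tendsto (fun x => (x / 2) ^ (-ν) * schlafliJ ν x) (nhdsWithin 0 (Set.Ioi 0))
      (nhds (1 / Real.Gamma (ν + 1))) := by
  have ha : 0 < -ν := by linarith
  have hE := tendsto_rpow_mul_schlafliExp ha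
  rw [neg_neg] at hE
  have hA : Tendsto (fun x => (x / 2) ^ (-ν) * schlafliCos 0 ν x) (nhdsWithin 0 (Set.Ioi 0))
      (nhds 0) :=
    (tendsto_half_rpow_nhdsGT_zero ha).zero_mul_isBoundedUnder_le
      (isBoundedUnder_of ⟨π, fun x => abs_schlafliCos_le 0 ν x⟩)
  have hlim := (hA.sub (hE.const_mul (Real.sin (ν * π)))).div_const π
  have hval : 1 / Real.Gamma (ν + 1) = (0 - Real.sin (ν * π) * Real.Gamma (-ν)) / π := by
    have hr := Real.Gamma_mul_Gamma_one_sub (-ν)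
    have hs : Real.sin (π * -ν) ≠ 0 :=
      (Real.sin_pos_of_pos_of_lt_pi (by positivity) (by nlinarith [Real.pi_pos])).ne'
    have e : Real.sin (ν * π) = -Real.sin (π * -ν) := by rw [← Real.sin_neg]; ring_nf
    have hG : Real.Gamma (ν + 1) ≠ 0 := (Real.Gamma_pos_of_pos (by linarith)).ne'
    rw [sub_neg_eq_add, add_comm] at hr
    rw [e, div_eq_div_iff hG Real.pi_ne_zero]
    linarith [(eq_div_iff hs).1 hr]
  rw [hval]
  refine hlim.congr fun x => ?_
  rw [schlafliJ]
  ring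

theorem tendsto_rpow_mul_schlafliJ {ν : ℝ} (hν : 0 < ν) :
    Tendsto (fun x => (x / 2) ^ ν * schlafliJ ν x) (nhdsWithin 0 (Set.Ioi 0)) (nhds 0) := by
  refine (tendsto_half_rpow_nhdsGT_zero hν).zero_mul_isBoundedUnder_le
    (isBoundedUnder_of_eventually_le (a := (π + 1 / ν) / π) ?_)
  filter_upwards [self_mem_nhdsWithin] with x hx
  have hx : 0 < x := hx
  have hE0 : 0 ≤ schlafliExp ν x :=
    setIntegral_nonneg measurableSet_Ioi fun t _ => (Real.exp_pos _).le
  have hE1 : schlafliExp ν x ≤ 1 / ν := by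
    have h3 := schlafliExp_three_term ν hx
    have p1 : 0 ≤ schlafliExp (ν - 1) x :=
      setIntegral_nonneg measurableSet_Ioi fun t _ => (Real.exp_pos _).le
    have p2 : 0 ≤ schlafliExp (ν + 1) x :=
      setIntegral_nonneg measurableSet_Ioi fun t _ => (Real.exp_pos _).le
    rw [le_div_iff₀ hν]
    have : 0 ≤ x / 2 * (schlafliExp (ν - 1) x + schlafliExp (ν + 1) x) := by positivity
    linarith
  rw [Function.comp_apply, schlafliJ, norm_div, Real.norm_of_nonneg Real.pi_pos.le]
  gcongr
  refine (norm_sub_le _ _).trans (add_le_add (abs_schlafliCos_le 0 ν x) ?_)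
  rw [norm_mul, Real.norm_of_nonneg hE0]
  exact (mul_le_of_le_one_left hE0 (Real.abs_sin_le_one _)).trans hE1

theorem besselJ_eq_schlafliJ_of_mem_Ioo {ν : ℝ} (h1 : -1 < ν) (h2 : ν < 0) {x : ℝ} (hx : 0 < x) :
    besselJ ν x = schlafliJ ν x ∧ besselJ (ν + 1) x = schlafliJ (ν + 1) x := by
  have hν : ∀ n : ℤ, ν ≠ n := by
    rintro n rfl
    have a1 : (-1 : ℤ) < n := by exact_mod_cast h1
    have a2 : n < (0 : ℤ) := by exact_mod_cast h2
    omega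
  have hpos : 0 < ν + 1 := by linarith
  have hJ : ∀ x, 0 < x →
      HasDerivAt (besselJ (ν + 1)) (besselJ ν x - (ν + 1) / x * besselJ (ν + 1) x) x := by
    intro x hx
    refine (hasDerivAt_besselJ (ν + 1) hx).congr_deriv ?_
    rw [besselJ_three_term hν hx, add_assoc, one_add_one_eq_two]
    ring
  have hJ1 : Tendsto (fun x => (x / 2) ^ (ν + 1) * besselJ (ν + 1) x) (nhdsWithin 0 (Set.Ioi 0))
      (nhds 0) := by
    have h := (tendsto_half_rpow_nhdsGT_zero (add_pos hpos hpos)).mul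
      (tendsto_rpow_neg_mul_besselJ (ν + 1))
    rw [zero_mul] at h
    refine h.congr' ?_
    filter_upwards [self_mem_nhdsWithin] with y hy
    rw [← mul_assoc, ← Real.rpow_add (half_pos hy), add_neg_cancel_right]
  have h := eq_zero_of_recurrence_of_tendsto_zero h1 h2
    (f := fun x => besselJ ν x - schlafliJ ν x)
    (g := fun x => besselJ (ν + 1) x - schlafliJ (ν + 1) x)
    (fun y hy => ((hasDerivAt_besselJ ν hy).sub
      (besselRecurrence_schlafliJ.hasDerivAt ν hy)).congr_deriv (by ring))
    (fun y hy => ((hJ y hy).sub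
      (besselRecurrence_schlafliJ.hasDerivAt_succ ν hy)).congr_deriv (by ring))
    (by simpa [mul_sub] using
      (tendsto_rpow_neg_mul_besselJ ν).sub (tendsto_rpow_neg_mul_schlafliJ h1 h2))
    (by simpa [mul_sub] using hJ1.sub (tendsto_rpow_mul_schlafliJ hpos)) hx
  exact ⟨sub_eq_zero.1 h.1, sub_eq_zero.1 h.2⟩

/-- **Schläfli's integral** for the Bessel functions of the first kind of non-integer order. -/
theorem besselJ_eq_schlafliJ {ν : ℝ} (hν : ∀ n : ℤ, ν ≠ n) {x : ℝ} (hx : 0 < x) :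
    besselJ ν x = schlafliJ ν x := by
  have hf0 : 0 < Int.fract ν := (Int.fract_nonneg ν).lt_of_ne fun h =>
    hν ⌊ν⌋ (by linarith [Int.self_sub_floor ν])
  have hf1 := Int.fract_lt_one ν
  set μ := Int.fract ν - 1 with hμ
  have hμn : ∀ m n : ℤ, μ + m ≠ n := fun m n h => hν (n - m + 1 + ⌊ν⌋) (by
    push_cast
    linarith [Int.self_sub_floor ν])
  have key : ∀ n : ℤ, besselJ (μ + n) x = schlafliJ (μ + n) x ∧
      besselJ (μ + n + 1) x = schlafliJ (μ + n + 1) x := by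
    intro n
    induction n using Int.induction_on with
    | zero => simpa using besselJ_eq_schlafliJ_of_mem_Ioo (by linarith) (by linarith) hx
    | succ n ih =>
      have h1 := besselJ_three_term (hμn n) hx
      have h2 := besselRecurrence_schlafliJ.eq_sub (μ + n) hx
      have e : μ + ((n + 1 : ℤ) : ℝ) = μ + n + 1 := by push_cast; ring
      have e2 : μ + (n : ℝ) + 1 + 1 = μ + n + 2 := by ring
      simp only [Int.cast_natCast] at ih h1
      rw [e, e2]
      refine ⟨ih.2, ?_⟩
      rw [ih.1, ih.2] at h1
      linarith
    | pred n ih =>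
      have h1 := besselJ_three_term (hμn (-n - 1)) hx
      have h2 := besselRecurrence_schlafliJ.eq_sub (μ + ((-n - 1 : ℤ) : ℝ)) hx
      have e : μ + ((-n - 1 : ℤ) : ℝ) + 1 = μ + ((-n : ℤ) : ℝ) := by push_cast; ring
      have e2 : μ + ((-n - 1 : ℤ) : ℝ) + 2 = μ + ((-n : ℤ) : ℝ) + 1 := by push_cast; ring
      rw [e]
      refine ⟨?_, ih.1⟩
      rw [h1, h2]
      have e3 : μ + ((-n - 1 : ℤ) : ℝ) + 1 = μ + ((-n : ℤ) : ℝ) := e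
      rw [e3, e2, ih.1, ih.2]
  have := (key (⌊ν⌋ + 1)).1
  have e : μ + ((⌊ν⌋ + 1 : ℤ) : ℝ) = ν := by
    push_cast
    linarith [Int.self_sub_floor ν]
  rwa [e] at this

end SchlafliJ

section SchlafliY

open MeasureTheory

theorem schlafliCos_zero_neg (ν x : ℝ) : schlafliCos 0 (-ν) x =
    Real.cos (ν * π) * schlafliCos 0 ν x - Real.sin (ν * π) * schlafliCos (π / 2) ν x := by
  have h := intervalIntegral.integral_comp_sub_left (a := 0) (b := π)
    (fun θ => Real.cos (-ν * θ - x * Real.sin θ + 0)) π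
  rw [sub_self, sub_zero] at h
  rw [schlafliCos, ← h, schlafliCos, schlafliCos, ← intervalIntegral.integral_const_mul,
    ← intervalIntegral.integral_const_mul, ← intervalIntegral.integral_sub]
  · refine intervalIntegral.integral_congr fun θ _ => ?_
    have e : -ν * (π - θ) - x * Real.sin (π - θ) + 0 =
        (ν * θ - x * Real.sin θ) - ν * π := by rw [Real.sin_pi_sub]; ring
    simp only [e, Real.cos_sub _ (ν * π), Real.cos_add_pi_div_two, add_zero]
    ring
  all_goals exact (by fun_prop : Continuous _).intervalIntegrable _ _

/-- **Schläfli's integral** for the Bessel functions of the second kind. -/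
theorem besselY_eq_schlafliY (ν : ℝ) {x : ℝ} (hx : 0 < x) : besselY ν x = schlafliY ν x := by
  have hcont : Continuous fun μ => schlafliY μ x := by
    have h1 := continuous_schlafliCos (π / 2) x
    have h2 := continuous_schlafliExp hx
    have h3 : Continuous fun μ => schlafliExp (-μ) x := h2.comp continuous_neg
    unfold schlafliY
    fun_prop
  have hne : (nhdsWithin ν {μ : ℝ | ∀ n : ℤ, μ ≠ (n : ℝ)}).NeBot := by
    rw [← mem_closure_iff_nhdsWithin_neBot]
    have hd : Dense (Set.range ((↑) : ℤ → ℝ))ᶜ :=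
      (Set.countable_range _).dense_compl ℝ
    have : {μ : ℝ | ∀ n : ℤ, μ ≠ (n : ℝ)} = (Set.range ((↑) : ℤ → ℝ))ᶜ := by
      ext μ
      simp [eq_comm]
    rw [this]
    exact hd ν
  refine Tendsto.limUnder_eq (((hcont.tendsto ν).mono_left nhdsWithin_le_nhds).congr' ?_)
  filter_upwards [self_mem_nhdsWithin] with μ hμ
  have hs : Real.sin (μ * π) ≠ 0 := fun h => by
    obtain ⟨n, hn⟩ := Real.sin_eq_zero_iff.1 h
    exact hμ n (mul_right_cancel₀ Real.pi_ne_zero hn).symm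
  have hμ' : ∀ n : ℤ, -μ ≠ n := fun n h => hμ (-n) (by push_cast; linarith)
  rw [besselJ_eq_schlafliJ hμ hx, besselJ_eq_schlafliJ hμ' hx, schlafliJ, schlafliJ, schlafliY,
    schlafliCos_zero_neg, neg_mul, Real.sin_neg]
  generalize Real.sin (μ * π) = s at hs ⊢
  generalize Real.cos (μ * π) = c
  field_simp
  ring

/-- The kernel `e^{νt} + e^{-νt} cos νπ` in Schläfli's integral for `Y_ν`. -/
noncomputable def schlafliKernel (ν t : ℝ) : ℝ :=
  Real.exp (ν * t) + Real.cos (ν * π) * Real.exp (-ν * t)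

theorem schlafliKernel_nonneg {ν t : ℝ} (hν : 0 ≤ ν) (ht : 0 ≤ t) : 0 ≤ schlafliKernel ν t := by
  have h1 : Real.exp (-ν * t) ≤ Real.exp (ν * t) :=
    Real.exp_le_exp.2 (by nlinarith [mul_nonneg hν ht])
  have h2 := Real.neg_one_le_cos (ν * π)
  unfold schlafliKernel
  nlinarith [Real.exp_pos (-ν * t)]

theorem exists_le_schlafliKernel {ν : ℝ} (hν : 0 ≤ ν) :
    ∃ c > 0, ∀ t, 1 ≤ t → c ≤ schlafliKernel ν t := by
  rcases hν.eq_or_lt with rfl | hpos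
  · exact ⟨2, two_pos, fun t _ => by norm_num [schlafliKernel]⟩
  · refine ⟨Real.exp ν - Real.exp (-ν), sub_pos.2 (Real.exp_lt_exp.2 (by linarith)),
      fun t ht => ?_⟩
    have h1 : Real.exp ν ≤ Real.exp (ν * t) := Real.exp_le_exp.2 (by nlinarith)
    have h2 : Real.exp (-ν * t) ≤ Real.exp (-ν) := Real.exp_le_exp.2 (by nlinarith)
    have h3 := Real.neg_one_le_cos (ν * π)
    unfold schlafliKernel
    nlinarith [Real.exp_pos (-ν * t)]

theorem mul_exp_le_setIntegral {w : ℝ → ℝ} {c x N : ℝ} (hx : 0 < x) (hN : 1 ≤ N)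
    (hc : 0 ≤ c) (hw0 : ∀ t, 0 < t → 0 ≤ w t) (hw : ∀ t, 1 ≤ t → c ≤ w t)
    (hi : IntegrableOn (fun t => w t * Real.exp (-(x * Real.sinh t))) (Set.Ioi 0)) :
    c * (N - 1) * Real.exp (-(x * Real.sinh N)) ≤
      ∫ t in Set.Ioi (0 : ℝ), w t * Real.exp (-(x * Real.sinh t)) := by
  have hsub : Set.Ioc 1 N ⊆ Set.Ioi (0 : ℝ) := fun t ht => one_pos.trans ht.1
  calc c * (N - 1) * Real.exp (-(x * Real.sinh N))
      = ∫ t in Set.Ioc 1 N, c * Real.exp (-(x * Real.sinh N)) := by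
        rw [setIntegral_const, Real.volume_real_Ioc_of_le hN, smul_eq_mul]
        ring
    _ ≤ ∫ t in Set.Ioc 1 N, w t * Real.exp (-(x * Real.sinh t)) := by
        refine setIntegral_mono_on (integrableOn_const (by simp)) (hi.mono_set hsub)
          measurableSet_Ioc fun t ht => ?_
        have h1 := hw t ht.1.le
        have h2 : Real.sinh t ≤ Real.sinh N := Real.sinh_le_sinh.2 ht.2
        have h3 : Real.exp (-(x * Real.sinh N)) ≤ Real.exp (-(x * Real.sinh t)) := by gcongr
        exact mul_le_mul h1 h3 (Real.exp_pos _).le (hc.trans h1)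
    _ ≤ _ := by
        refine setIntegral_mono_set hi ?_ (LE.le.eventuallyLE hsub)
        filter_upwards [ae_restrict_mem measurableSet_Ioi] with t ht
        exact mul_nonneg (hw0 t ht) (Real.exp_pos _).le

theorem pi_mul_schlafliY (ν : ℝ) {x : ℝ} (hx : 0 < x) :
    IntegrableOn (fun t => schlafliKernel ν t * Real.exp (-(x * Real.sinh t))) (Set.Ioi 0) ∧
    π * schlafliY ν x = schlafliCos (π / 2) ν x -
      ∫ t in Set.Ioi (0 : ℝ), schlafliKernel ν t * Real.exp (-(x * Real.sinh t)) := by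
  have i1 := integrableOn_exp_mul_sub_mul_sinh (-ν) hx
  have i2 := integrableOn_exp_mul_sub_mul_sinh (- -ν) hx
  have e : (fun t => schlafliKernel ν t * Real.exp (-(x * Real.sinh t))) = fun t =>
      Real.exp (- -ν * t - x * Real.sinh t) +
        Real.cos (ν * π) * Real.exp (-ν * t - x * Real.sinh t) := by
    ext t
    rw [schlafliKernel, sub_eq_add_neg, sub_eq_add_neg, Real.exp_add, Real.exp_add, neg_neg]
    ring
  rw [e, integral_add i2 (i1.const_mul _), integral_const_mul]
  refine ⟨i2.add (i1.const_mul _), ?_⟩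
  rw [schlafliY, schlafliExp, schlafliExp]
  field_simp
  ring

theorem pi_mul_deriv_schlafliY (ν : ℝ) {x : ℝ} (hx : 0 < x) :
    IntegrableOn (fun t => schlafliKernel ν t * Real.sinh t * Real.exp (-(x * Real.sinh t)))
      (Set.Ioi 0) ∧
    π * deriv (schlafliY ν) x =
      (∫ θ in (0 : ℝ)..π, Real.sin θ * Real.cos (ν * θ - x * Real.sin θ)) +
      ∫ t in Set.Ioi (0 : ℝ),
        schlafliKernel ν t * Real.sinh t * Real.exp (-(x * Real.sinh t)) := by
  obtain ⟨i1, d1⟩ := hasDerivAt_schlafliExp_integral ν hx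
  obtain ⟨i2, d2⟩ := hasDerivAt_schlafliExp_integral (-ν) hx
  have hd := (((hasDerivAt_schlafliCos_integral (π / 2) ν x).sub d2).sub
    (d1.const_mul (Real.cos (ν * π)))).div_const π
  have hd' : deriv (schlafliY ν) x = _ := hd.deriv
  have e : (fun t => schlafliKernel ν t * Real.sinh t * Real.exp (-(x * Real.sinh t))) = fun t =>
      -(-Real.sinh t * Real.exp (- -ν * t - x * Real.sinh t)) -
        Real.cos (ν * π) * (-Real.sinh t * Real.exp (-ν * t - x * Real.sinh t)) := by
    ext t
    rw [schlafliKernel, sub_eq_add_neg (- -ν * t), sub_eq_add_neg (-ν * t), Real.exp_add,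
      Real.exp_add, neg_neg]
    ring
  have i3 : IntegrableOn
      (fun t => -(-Real.sinh t * Real.exp (- -ν * t - x * Real.sinh t))) (Set.Ioi 0) := i2.neg
  rw [e, integral_sub i3 (i1.const_mul _), integral_const_mul, integral_neg]
  refine ⟨i3.sub (i1.const_mul _), ?_⟩
  rw [hd']
  simp only [Real.sin_add_pi_div_two]
  rw [mul_div_cancel₀ _ Real.pi_ne_zero]
  ring

theorem one_le_sinh {t : ℝ} (ht : 1 ≤ t) : 1 ≤ Real.sinh t :=
  ht.trans (Real.self_le_sinh_iff.2 (by linarith))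

theorem le_schlafliKernel_mul_sinh {ν c : ℝ} (hc : 0 < c)
    (h : ∀ t, 1 ≤ t → c ≤ schlafliKernel ν t) :
    ∀ t, 1 ≤ t → c ≤ schlafliKernel ν t * Real.sinh t := fun t ht =>
  (h t ht).trans (le_mul_of_one_le_right (hc.le.trans (h t ht)) (one_le_sinh ht))

theorem schlafliKernel_mul_sinh_nonneg {ν t : ℝ} (hν : 0 ≤ ν) (ht : 0 < t) :
    0 ≤ schlafliKernel ν t * Real.sinh t :=
  mul_nonneg (schlafliKernel_nonneg hν ht.le) (Real.sinh_nonneg_iff.2 ht.le)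

/-- Near the origin, `Y_ν` is negative and increasing. -/
theorem schlafliY_neg_and_deriv_pos_near_zero {ν : ℝ} (hν : 0 ≤ ν) :
    ∃ δ > 0, ∀ x, 0 < x → x ≤ δ → schlafliY ν x < 0 ∧ 0 < deriv (schlafliY ν) x := by
  obtain ⟨c, hc, hk⟩ := exists_le_schlafliKernel hν
  set N : ℝ := 1 + 4 * Real.exp 1 / c with hN
  have hN1 : 1 ≤ N := by
    have : 0 ≤ 4 * Real.exp 1 / c := by positivity
    linarith
  have hsN : 0 < Real.sinh N := one_pos.trans_le (one_le_sinh hN1)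
  refine ⟨1 / Real.sinh N, by positivity, fun x hx hxδ => ?_⟩
  have hb : 4 ≤ c * (N - 1) * Real.exp (-(x * Real.sinh N)) := by
    have h1 : x * Real.sinh N ≤ 1 := (le_div_iff₀ hsN).1 hxδ
    have h2 : Real.exp (-1) ≤ Real.exp (-(x * Real.sinh N)) := Real.exp_le_exp.2 (by linarith)
    have h3 : c * (N - 1) = 4 * Real.exp 1 := by rw [hN]; field_simp; ring
    calc (4 : ℝ) = 4 * Real.exp 1 * Real.exp (-1) := by
          rw [mul_assoc, ← Real.exp_add]; simp
      _ ≤ _ := by rw [h3]; gcongr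
  have hpi := Real.pi_pos
  have hpi4 := Real.pi_lt_four
  constructor
  · obtain ⟨hi, he⟩ := pi_mul_schlafliY ν hx
    have h1 := mul_exp_le_setIntegral hx hN1 hc.le
      (fun t ht => schlafliKernel_nonneg hν (le_of_lt ht)) hk hi
    have h2 := (abs_le.1 (abs_schlafliCos_le (π / 2) ν x)).2
    by_contra! h
    have := mul_nonneg hpi.le h
    linarith
  · obtain ⟨hi, he⟩ := pi_mul_deriv_schlafliY ν hx
    have h1 := mul_exp_le_setIntegral hx hN1 hc.le
      (fun t ht => schlafliKernel_mul_sinh_nonneg hν ht) (le_schlafliKernel_mul_sinh hc hk) hi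
    have h2 : |∫ θ in (0 : ℝ)..π, Real.sin θ * Real.cos (ν * θ - x * Real.sin θ)| ≤ π := by
      have := intervalIntegral.norm_integral_le_of_norm_le_const (a := 0) (b := π) (C := 1)
        (f := fun θ => Real.sin θ * Real.cos (ν * θ - x * Real.sin θ)) (fun θ _ => by
          rw [norm_mul]
          exact mul_le_one₀ (Real.abs_sin_le_one _) (norm_nonneg _) (Real.abs_cos_le_one _))
      simpa [abs_of_pos hpi] using this
    have h3 := (abs_le.1 h2).1
    by_contra! h
    have := mul_nonpos_of_nonneg_of_nonpos hpi.le h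
    linarith

theorem integral_sin_mul_cos_nonneg {μ : ℝ} (hμ : 0 < μ) :
    0 ≤ ∫ θ in (0 : ℝ)..π, Real.sin θ * Real.cos (μ * θ - μ * Real.sin θ) := by
  set g : ℝ → ℝ := fun θ => Real.sin θ * Real.cos (μ * θ - μ * Real.sin θ) with hg
  have hgc : Continuous g := by fun_prop
  set F : ℝ → ℝ := fun θ =>
    Real.sin θ * Real.sin (μ * θ - μ * Real.sin θ) / (μ * (1 - Real.cos θ)) +
      (1 - Real.cos (μ * θ - μ * Real.sin θ)) / (μ ^ 2 * (1 - Real.cos θ) ^ 2) with hF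
  have hcos : ∀ θ, 0 < θ → θ ≤ π → 0 < 1 - Real.cos θ := fun θ h0 h1 => by
    have := Real.cos_lt_cos_of_nonneg_of_le_pi le_rfl h1 h0
    rw [Real.cos_zero] at this
    linarith
  have hderiv : ∀ θ, 0 < θ → θ ≤ π → HasDerivAt (fun t => (∫ u in (0 : ℝ)..t, g u) - F t)
      (2 * Real.sin θ * (1 - Real.cos (μ * θ - μ * Real.sin θ)) /
        (μ ^ 2 * (1 - Real.cos θ) ^ 3)) θ := fun θ h0 h1 => by
    have hc := (hcos θ h0 h1).ne'
    have d0 := intervalIntegral.integral_hasDerivAt_right (hgc.intervalIntegrable 0 θ)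
      (hgc.stronglyMeasurableAtFilter _ _) hgc.continuousAt
    have ds := Real.hasDerivAt_sin θ
    have dc := (Real.hasDerivAt_cos θ).const_sub 1
    have dφ := ((hasDerivAt_id' θ).const_mul μ).sub (ds.const_mul μ)
    have d1 := (ds.mul dφ.sin).div (dc.const_mul μ) (mul_ne_zero hμ.ne' hc)
    have d2 := (dφ.cos.const_sub 1).div ((dc.pow 2).const_mul (μ ^ 2))
      (mul_ne_zero (pow_ne_zero 2 hμ.ne') (pow_ne_zero 2 hc))
    refine (d0.sub (d1.add d2)).congr_deriv ?_
    have hsc := Real.sin_sq θ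
    simp only [hg, Pi.mul_apply, Pi.sub_apply, Pi.pow_apply]
    generalize Real.sin (μ * θ - μ * Real.sin θ) = S
    generalize Real.cos (μ * θ - μ * Real.sin θ) = C
    generalize Real.sin θ = s at *
    generalize Real.cos θ = c at *
    simp only [Nat.cast_ofNat, Nat.add_one_sub_one, pow_one]
    field_simp
    linear_combination μ * (1 - c) * S * hsc
  have key : ∀ ε, 0 < ε → ε ≤ 1 → -(3 * ε) ≤ ∫ u in (0 : ℝ)..π, g u := fun ε h0 h1 => by
    have hεπ : ε ≤ π := h1.trans (by linarith [Real.pi_gt_three])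
    have hmono : MonotoneOn (fun t => (∫ u in (0 : ℝ)..t, g u) - F t) (Set.Icc ε π) := by
      refine monotoneOn_of_hasDerivWithinAt_nonneg (convex_Icc ε π)
        (fun θ hθ => (hderiv θ (h0.trans_le hθ.1) hθ.2).continuousAt.continuousWithinAt)
        (fun θ hθ => ?_) (fun θ hθ => ?_) (f' := fun θ =>
          2 * Real.sin θ * (1 - Real.cos (μ * θ - μ * Real.sin θ)) /
          (μ ^ 2 * (1 - Real.cos θ) ^ 3))
      · rw [interior_Icc] at hθ
        exact (hderiv θ (h0.trans hθ.1) hθ.2.le).hasDerivWithinAt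
      · rw [interior_Icc] at hθ
        have a1 := hcos θ (h0.trans hθ.1) hθ.2.le
        have a2 := Real.sin_pos_of_pos_of_lt_pi (h0.trans hθ.1) hθ.2
        have a3 := sub_nonneg.2 (Real.cos_le_one (μ * θ - μ * Real.sin θ))
        positivity
    have hH := hmono (Set.left_mem_Icc.2 hεπ) (Set.right_mem_Icc.2 hεπ) hεπ
    have hFπ : 0 ≤ F π := by
      have a3 := sub_nonneg.2 (Real.cos_le_one (μ * π - μ * Real.sin π))
      simp only [hF, Real.sin_pi, zero_mul, zero_div, zero_add] at *
      positivity
    have hG : -ε ≤ ∫ u in (0 : ℝ)..ε, g u := by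
      have := intervalIntegral.norm_integral_le_of_norm_le_const (a := 0) (b := ε) (C := 1)
        (f := g) (fun θ _ => by
          rw [norm_mul]
          exact mul_le_one₀ (Real.abs_sin_le_one _) (norm_nonneg _) (Real.abs_cos_le_one _))
      rw [sub_zero, abs_of_pos h0, one_mul] at this
      exact (abs_le.1 this).1
    have hFε : F ε ≤ 2 * ε := by
      have b1 := Real.sin_gt_sub_cube h0
      have b2 := Real.sin_lt h0
      have b3 := Real.sin_pos_of_pos_of_le_one h0 h1
      have b4 : ε ^ 2 / 4 ≤ 1 - Real.cos ε := by
        have := (abs_le.1 (Real.cos_bound (x := ε) (by rwa [abs_of_pos h0]))).2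
        rw [abs_of_pos h0] at this
        nlinarith [pow_le_pow_of_le_one h0.le h1 (show 2 ≤ 4 by norm_num), sq_nonneg ε]
      set φ := ε - Real.sin ε with hφ
      have b5 : μ * ε - μ * Real.sin ε = μ * φ := by rw [hφ]; ring
      have b6 : φ ≤ ε ^ 3 / 4 := by linarith
      have b7 : 0 < φ := by linarith
      have b8 : Real.sin (μ * φ) ≤ μ * φ := Real.sin_le (by positivity)
      have b9 : 1 - Real.cos (μ * φ) ≤ (μ * φ) ^ 2 / 2 := by
        linarith [Real.one_sub_sq_div_two_le_cos (x := μ * φ)]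
      have c1 : Real.sin ε * Real.sin (μ * φ) / (μ * (1 - Real.cos ε)) ≤
          ε * (μ * (ε ^ 3 / 4)) / (μ * (ε ^ 2 / 4)) := by
        have : Real.sin ε * Real.sin (μ * φ) ≤ ε * (μ * (ε ^ 3 / 4)) :=
          (mul_le_mul_of_nonneg_left b8 b3.le).trans (by gcongr)
        gcongr
      have c2 : (1 - Real.cos (μ * φ)) / (μ ^ 2 * (1 - Real.cos ε) ^ 2) ≤
          ((μ * (ε ^ 3 / 4)) ^ 2 / 2) / (μ ^ 2 * (ε ^ 2 / 4) ^ 2) := by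
        have : 1 - Real.cos (μ * φ) ≤ (μ * (ε ^ 3 / 4)) ^ 2 / 2 := b9.trans (by gcongr)
        gcongr
      have c3 : ε * (μ * (ε ^ 3 / 4)) / (μ * (ε ^ 2 / 4)) = ε ^ 2 := by field_simp
      have c4 : ((μ * (ε ^ 3 / 4)) ^ 2 / 2) / (μ ^ 2 * (ε ^ 2 / 4) ^ 2) = ε ^ 2 / 2 := by
        field_simp
      simp only [hF, b5]
      nlinarith
    linarith
  refine le_of_forall_pos_le_add fun ε hε => ?_
  have h1 := key (min 1 (ε / 3)) (by positivity) (min_le_left _ _)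
  have h2 := min_le_right 1 (ε / 3)
  linarith

theorem deriv_schlafliY_self_pos {μ : ℝ} (hμ : 0 < μ) : 0 < deriv (schlafliY μ) μ := by
  obtain ⟨c, hc, hk⟩ := exists_le_schlafliKernel hμ.le
  obtain ⟨hi, he⟩ := pi_mul_deriv_schlafliY μ hμ
  have h1 := mul_exp_le_setIntegral hμ one_le_two hc.le
    (fun t ht => schlafliKernel_mul_sinh_nonneg hμ.le ht) (le_schlafliKernel_mul_sinh hc hk) hi
  have h2 : 0 < c * (2 - 1) * Real.exp (-(μ * Real.sinh 2)) := by
    norm_num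
    positivity
  have h3 := integral_sin_mul_cos_nonneg hμ
  exact pos_of_mul_pos_right (by linarith) Real.pi_pos.le

end SchlafliY

section SignChanges

theorem forall_pos_or_forall_neg_of_ne_zero {f : ℝ → ℝ} {s : Set ℝ} (hs : IsPreconnected s)
    (hf : ContinuousOn f s) (h : ∀ x ∈ s, f x ≠ 0) :
    (∀ x ∈ s, 0 < f x) ∨ ∀ x ∈ s, f x < 0 := by
  by_contra! hc
  obtain ⟨⟨x, hx, hx0⟩, y, hy, hy0⟩ := hc
  obtain ⟨z, hz, hz0⟩ := hs.intermediate_value hx hy hf ⟨hx0, hy0⟩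
  exact h z hz hz0

theorem exists_first_zero {f : ℝ → ℝ} {a b : ℝ} (hab : a ≤ b) (hf : ContinuousOn f (Set.Icc a b))
    (ha : 0 < f a) (hb : f b ≤ 0) :
    ∃ c ∈ Set.Ioc a b, f c = 0 ∧ ∀ t ∈ Set.Ico a c, 0 < f t := by
  have hcl : IsClosed {t ∈ Set.Icc a b | f t ≤ 0} :=
    hf.preimage_isClosed_of_isClosed isClosed_Icc isClosed_Iic
  have hcpt : IsCompact {t ∈ Set.Icc a b | f t ≤ 0} :=
    isCompact_Icc.of_isClosed_subset hcl fun t ht => ht.1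
  obtain ⟨c, ⟨hc, hc0⟩, hmin⟩ := hcpt.exists_isLeast ⟨b, ⟨hab, le_rfl⟩, hb⟩
  have hpos : ∀ t ∈ Set.Ico a c, 0 < f t := fun t ht => by
    by_contra! h
    exact (hmin ⟨⟨ht.1, ht.2.le.trans hc.2⟩, h⟩).not_gt ht.2
  have hac : a < c := hc.1.lt_of_ne fun h => (h ▸ hc0).not_gt ha
  refine ⟨c, ⟨hac, hc.2⟩, hc0.eq_of_not_lt fun hlt => ?_, hpos⟩
  obtain ⟨z, hz, hz0⟩ := intermediate_value_Icc' hc.1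
    (hf.mono (Set.Icc_subset_Icc_right hc.2)) ⟨hlt.le, ha.le⟩
  rcases hz.2.lt_or_eq with h | h
  · exact (hpos z ⟨hz.1, h⟩).ne' hz0
  · exact hlt.ne (h ▸ hz0)

theorem exists_first_pos_zero {f : ℝ → ℝ} (hf : ContinuousOn f (Set.Ioi 0)) {δ b : ℝ} (hδ : 0 < δ)
    (hpos : ∀ x, 0 < x → x ≤ δ → 0 < f x) (hb0 : 0 < b) (hb : f b ≤ 0) :
    ∃ c, 0 < c ∧ c ≤ b ∧ f c = 0 ∧ ∀ t, 0 < t → t < c → 0 < f t := by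
  have hδb : δ ≤ b := by
    by_contra! h
    exact (hpos b hb0 h.le).not_ge hb
  obtain ⟨c, hc, hc0, hct⟩ := exists_first_zero hδb
    (hf.mono fun t ht => hδ.trans_le ht.1) (hpos δ hδ le_rfl) hb
  refine ⟨c, hδ.trans hc.1, hc.2, hc0, fun t ht htc => ?_⟩
  rcases le_total t δ with h | h
  · exact hpos t ht h
  · exact hct t ⟨h, htc⟩

theorem HasDerivAt.nonpos_of_nonneg_left {f : ℝ → ℝ} {a b q : ℝ} (hd : HasDerivAt f q b)
    (hab : a < b) (hb : f b = 0) (h : ∀ x ∈ Set.Ioo a b, 0 ≤ f x) : q ≤ 0 := by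
  have ht := (hasDerivWithinAt_iff_tendsto_slope' (s := Set.Iio b) (by simp)).1
    hd.hasDerivWithinAt
  refine le_of_tendsto ht ?_
  filter_upwards [Ioo_mem_nhdsLT hab] with x hx
  rw [slope_def_field, hb, sub_zero]
  exact div_nonpos_of_nonneg_of_nonpos (h x hx) (sub_nonpos.2 hx.2.le)

theorem HasDerivAt.nonneg_of_nonneg_right {f : ℝ → ℝ} {a b p : ℝ} (hd : HasDerivAt f p a)
    (hab : a < b) (ha : f a = 0) (h : ∀ x ∈ Set.Ioo a b, 0 ≤ f x) : 0 ≤ p := by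
  have ht := (hasDerivWithinAt_iff_tendsto_slope' (s := Set.Ioi a) (by simp)).1
    hd.hasDerivWithinAt
  refine ge_of_tendsto ht ?_
  filter_upwards [Ioo_mem_nhdsGT hab] with x hx
  rw [slope_def_field, ha, sub_zero]
  exact div_nonneg (h x hx) (sub_nonneg.2 hx.1.le)

/-- If `g` has the same (or the opposite) sign as `f'` at two consecutive zeros of `f`, then `g`
vanishes between them. -/
theorem exists_zero_between_zeros {f g : ℝ → ℝ} {a b p q : ℝ} (hab : a < b)
    (hf : ContinuousOn f (Set.Icc a b)) (hg : ContinuousOn g (Set.Icc a b))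
    (hfa : HasDerivAt f p a) (hfb : HasDerivAt f q b) (ha : f a = 0) (hb : f b = 0)
    (hne : ∀ x ∈ Set.Ioo a b, f x ≠ 0) (hpq : 0 < (p * g a) * (q * g b)) :
    ∃ c ∈ Set.Ioo a b, g c = 0 := by
  by_contra! hc
  have hg0 : ∀ x ∈ Set.Icc a b, g x ≠ 0 := fun x hx h0 => by
    rcases hx.1.eq_or_lt with rfl | h1
    · simp [h0] at hpq
    rcases hx.2.eq_or_lt with rfl | h2
    · simp [h0] at hpq
    exact hc x ⟨h1, h2⟩ h0
  have hgg : 0 < g a * g b := by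
    rcases forall_pos_or_forall_neg_of_ne_zero isPreconnected_Icc hg hg0 with h | h
    · exact mul_pos (h a (Set.left_mem_Icc.2 hab.le)) (h b (Set.right_mem_Icc.2 hab.le))
    · exact mul_pos_of_neg_of_neg (h a (Set.left_mem_Icc.2 hab.le))
        (h b (Set.right_mem_Icc.2 hab.le))
  have hpq' : 0 < p * q := by
    refine pos_of_mul_pos_left ?_ hgg.le
    linarith
  rcases forall_pos_or_forall_neg_of_ne_zero isPreconnected_Ioo
    (hf.mono Set.Ioo_subset_Icc_self) hne with h | h
  · have h1 := hfa.nonneg_of_nonneg_right hab ha fun x hx => (h x hx).le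
    have h2 := hfb.nonpos_of_nonneg_left hab hb fun x hx => (h x hx).le
    exact hpq'.not_ge (mul_nonpos_of_nonneg_of_nonpos h1 h2)
  · have h1 := hfa.neg.nonneg_of_nonneg_right hab (by simp [ha])
      fun x hx => neg_nonneg.2 (h x hx).le
    have h2 := hfb.neg.nonpos_of_nonneg_left hab (by simp [hb])
      fun x hx => neg_nonneg.2 (h x hx).le
    nlinarith

namespace IsPosZeroSeq

variable {f g : ℝ → ℝ} {a b : ℕ → ℝ}

theorem congr (h : IsPosZeroSeq f a) (hfg : ∀ x, 0 < x → f x = g x) : IsPosZeroSeq g a where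
  pos := h.pos
  mono := h.mono
  isZero s hs := (hfg _ (h.pos s hs)).symm.trans (h.isZero s hs)
  complete x hx hx0 := h.complete x hx ((hfg x hx).trans hx0)

theorem le_of_le (h : IsPosZeroSeq f a) {s t : ℕ} (hs : 1 ≤ s) (hst : s ≤ t) : a s ≤ a t := by
  rcases hst.eq_or_lt with rfl | hlt
  · exact le_rfl
  · exact (h.mono s t hs hlt).le

theorem lt_of_lt (h : IsPosZeroSeq f a) {s t : ℕ} (ht : 1 ≤ t) (hst : a s < a t) : s < t := by
  by_contra! hts
  exact (h.le_of_le ht hts).not_gt hst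

theorem one_le (h : IsPosZeroSeq f a) {x : ℝ} (hx : 0 < x) (hx0 : f x = 0) : a 1 ≤ x := by
  obtain ⟨s, hs, rfl⟩ := h.complete x hx hx0
  exact h.le_of_le le_rfl hs

theorem ne_zero_of_mem_Ioo (h : IsPosZeroSeq f a) {s : ℕ} (hs : 1 ≤ s) {x : ℝ}
    (hx : x ∈ Set.Ioo (a s) (a (s + 1))) : f x ≠ 0 := fun hx0 => by
  obtain ⟨t, ht, rfl⟩ := h.complete x ((h.pos s hs).trans hx.1) hx0
  have h1 := h.lt_of_lt ht hx.1
  have h2 := h.lt_of_lt (by omega) hx.2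
  omega

/-- Two sequences of zeros interlace as soon as each function vanishes between consecutive zeros
of the other one. -/
theorem interlace (hf : IsPosZeroSeq f a) (hg : IsPosZeroSeq g b) (h1 : a 1 < b 1)
    (hfg : ∀ s, 1 ≤ s → ∃ c ∈ Set.Ioo (a s) (a (s + 1)), g c = 0)
    (hgf : ∀ s, 1 ≤ s → ∃ c ∈ Set.Ioo (b s) (b (s + 1)), f c = 0) :
    ∀ s, 1 ≤ s → a s < b s ∧ b s < a (s + 1) := by
  intro s hs
  induction s, hs using Nat.le_induction with
  | base =>
    obtain ⟨c, hc, hc0⟩ := hfg 1 le_rfl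
    exact ⟨h1, (hg.one_le ((hf.pos 1 le_rfl).trans hc.1) hc0).trans_lt hc.2⟩
  | succ s hs ih =>
    have hab : a (s + 1) < b (s + 1) := by
      obtain ⟨c, hc, hc0⟩ := hgf s hs
      obtain ⟨t, ht, rfl⟩ := hf.complete c ((hg.pos s hs).trans hc.1) hc0
      have hst := hf.lt_of_lt ht (ih.1.trans hc.1)
      exact (hf.le_of_le (by omega) hst).trans_lt hc.2
    refine ⟨hab, ?_⟩
    obtain ⟨c, hc, hc0⟩ := hfg (s + 1) (by omega)
    obtain ⟨t, ht, rfl⟩ := hg.complete c ((hf.pos (s + 1) (by omega)).trans hc.1) hc0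
    have hst := hg.lt_of_lt ht (ih.2.trans hc.1)
    exact (hg.le_of_le (by omega) hst).trans_lt hc.2

end IsPosZeroSeq

end SignChanges

section DerivZeros

theorem hasDerivAt_schlafliY (ν : ℝ) {x : ℝ} (hx : 0 < x) :
    HasDerivAt (schlafliY ν) (deriv (schlafliY ν) x) x :=
  (besselRecurrence_schlafliY.hasDerivAt ν hx).differentiableAt.hasDerivAt

theorem deriv_schlafliY (ν : ℝ) {x : ℝ} (hx : 0 < x) :
    deriv (schlafliY ν) x = ν / x * schlafliY ν x - schlafliY (ν + 1) x :=
  (besselRecurrence_schlafliY.hasDerivAt ν hx).deriv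

theorem deriv_schlafliY_succ (ν : ℝ) {x : ℝ} (hx : 0 < x) :
    deriv (schlafliY (ν + 1)) x = schlafliY ν x - (ν + 1) / x * schlafliY (ν + 1) x :=
  (besselRecurrence_schlafliY.hasDerivAt_succ ν hx).deriv

theorem hasDerivAt_deriv_schlafliY (ν : ℝ) {x : ℝ} (hx : 0 < x) :
    HasDerivAt (deriv (schlafliY ν)) (-(ν / x ^ 2) * schlafliY ν x +
      ν / x * deriv (schlafliY ν) x - deriv (schlafliY (ν + 1)) x) x := by
  have h := (((hasDerivAt_inv hx.ne').const_mul ν).mul (hasDerivAt_schlafliY ν hx)).sub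
    (hasDerivAt_schlafliY (ν + 1) hx)
  refine (h.congr_of_eventuallyEq ?_).congr_deriv (by field_simp)
  filter_upwards [Ioi_mem_nhds hx] with t ht
  rw [deriv_schlafliY ν ht, div_eq_mul_inv]
  rfl

theorem hasDerivAt_deriv_schlafliY_succ (ν : ℝ) {x : ℝ} (hx : 0 < x) :
    HasDerivAt (deriv (schlafliY (ν + 1))) (deriv (schlafliY ν) x +
      (ν + 1) / x ^ 2 * schlafliY (ν + 1) x -
      (ν + 1) / x * deriv (schlafliY (ν + 1)) x) x := by
  have h := (hasDerivAt_schlafliY ν hx).sub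
    (((hasDerivAt_inv hx.ne').const_mul (ν + 1)).mul (hasDerivAt_schlafliY (ν + 1) hx))
  refine (h.congr_of_eventuallyEq ?_).congr_deriv (by field_simp; ring)
  filter_upwards [Ioi_mem_nhds hx] with t ht
  rw [deriv_schlafliY_succ ν ht, div_eq_mul_inv]
  rfl

theorem continuousOn_deriv_schlafliY (ν : ℝ) : ContinuousOn (deriv (schlafliY ν)) (Set.Ioi 0) :=
  fun _ hx => (hasDerivAt_deriv_schlafliY ν hx).continuousAt.continuousWithinAt

theorem continuousOn_schlafliY (ν : ℝ) : ContinuousOn (schlafliY ν) (Set.Ioi 0) :=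
  fun _ hx => (hasDerivAt_schlafliY ν hx).continuousAt.continuousWithinAt

/-- **Bessel's equation** in self-adjoint form. -/
theorem hasDerivAt_mul_deriv_schlafliY (ν : ℝ) {x : ℝ} (hx : 0 < x) :
    HasDerivAt (fun t => t * deriv (schlafliY ν) t)
      ((ν ^ 2 - x ^ 2) / x * schlafliY ν x) x := by
  refine ((hasDerivAt_id' x).mul (hasDerivAt_deriv_schlafliY ν hx)).congr_deriv ?_
  rw [deriv_schlafliY ν hx, deriv_schlafliY_succ ν hx]
  field_simp
  ring

theorem monotoneOn_mul_deriv_schlafliY {ν a b : ℝ} (ha : 0 < a)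
    (h : ∀ x ∈ Set.Ioo a b, 0 ≤ (ν ^ 2 - x ^ 2) * schlafliY ν x) :
    MonotoneOn (fun t => t * deriv (schlafliY ν) t) (Set.Icc a b) := by
  refine monotoneOn_of_hasDerivWithinAt_nonneg (convex_Icc a b)
    (fun x hx => (hasDerivAt_mul_deriv_schlafliY ν
      (ha.trans_le hx.1)).continuousAt.continuousWithinAt)
    (f' := fun x => (ν ^ 2 - x ^ 2) / x * schlafliY ν x) (fun x hx => ?_) fun x hx => ?_
  · rw [interior_Icc] at hx
    exact (hasDerivAt_mul_deriv_schlafliY ν (ha.trans hx.1)).hasDerivWithinAt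
  · rw [interior_Icc] at hx
    rw [div_mul_eq_mul_div]
    exact div_nonneg (h x hx) (ha.trans hx.1).le

theorem antitoneOn_mul_deriv_schlafliY {ν a b : ℝ} (ha : 0 < a)
    (h : ∀ x ∈ Set.Ioo a b, (ν ^ 2 - x ^ 2) * schlafliY ν x ≤ 0) :
    AntitoneOn (fun t => t * deriv (schlafliY ν) t) (Set.Icc a b) := by
  refine antitoneOn_of_hasDerivWithinAt_nonpos (convex_Icc a b)
    (fun x hx => (hasDerivAt_mul_deriv_schlafliY ν
      (ha.trans_le hx.1)).continuousAt.continuousWithinAt)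
    (f' := fun x => (ν ^ 2 - x ^ 2) / x * schlafliY ν x) (fun x hx => ?_) fun x hx => ?_
  · rw [interior_Icc] at hx
    exact (hasDerivAt_mul_deriv_schlafliY ν (ha.trans hx.1)).hasDerivWithinAt
  · rw [interior_Icc] at hx
    rw [div_mul_eq_mul_div]
    exact div_nonpos_of_nonpos_of_nonneg (h x hx) (ha.trans hx.1).le

theorem schlafliY_succ_ne_zero_of_eq_zero {ν : ℝ} (hν : 0 ≤ ν) {x : ℝ} (hx : 0 < x)
    (h0 : schlafliY ν x = 0) : schlafliY (ν + 1) x ≠ 0 := fun h1 => by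
  obtain ⟨δ, hδ, hneg⟩ := schlafliY_neg_and_deriv_pos_near_zero hν
  set G : ℝ → ℝ := fun t =>
    t ^ (2 * ν + 2) * (schlafliY ν t ^ 2 + schlafliY (ν + 1) t ^ 2) with hG
  have hd : ∀ t, 0 < t → HasDerivAt G
      (t ^ (2 * ν + 1) * ((4 * ν + 2) * schlafliY ν t ^ 2)) t := fun t ht => by
    have h := (Real.hasDerivAt_rpow_const (p := 2 * ν + 2) (Or.inl ht.ne')).mul
      (((besselRecurrence_schlafliY.hasDerivAt ν ht).pow 2).add
        ((besselRecurrence_schlafliY.hasDerivAt_succ ν ht).pow 2))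
    refine h.congr_deriv ?_
    have e1 : 2 * ν + 2 - 1 = 2 * ν + 1 := by ring
    have e2 : t ^ (2 * ν + 2) = t ^ (2 * ν + 1) * t := by
      rw [← Real.rpow_add_one ht.ne']
      ring_nf
    simp only [Pi.add_apply, Pi.pow_apply, e1, e2]
    field_simp
    push_cast
    ring
  set ε := min δ x with hε
  have hε0 : 0 < ε := lt_min hδ hx
  have hmono : MonotoneOn G (Set.Icc ε x) := by
    refine monotoneOn_of_hasDerivWithinAt_nonneg (convex_Icc ε x)
      (fun t ht => (hd t (hε0.trans_le ht.1)).continuousAt.continuousWithinAt)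
      (f' := fun t => t ^ (2 * ν + 1) * ((4 * ν + 2) * schlafliY ν t ^ 2))
      (fun t ht => ?_) fun t ht => ?_
    · rw [interior_Icc] at ht
      exact (hd t (hε0.trans ht.1)).hasDerivWithinAt
    · rw [interior_Icc] at ht
      have := hε0.trans ht.1
      positivity
  have hle := hmono (Set.left_mem_Icc.2 (min_le_right _ _))
    (Set.right_mem_Icc.2 (min_le_right _ _)) (min_le_right _ _)
  have hpos : 0 < G ε := by
    have := (hneg ε hε0 (min_le_left _ _)).1
    have := sq_pos_of_neg this
    simp only [hG]
    positivity
  simp only [hG, h0, h1] at hle hpos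
  norm_num at hle
  linarith

theorem deriv_schlafliY_ne_zero_of_eq_zero {ν : ℝ} (hν : 0 ≤ ν) {x : ℝ} (hx : 0 < x)
    (h0 : schlafliY ν x = 0) : deriv (schlafliY ν) x ≠ 0 := by
  rw [deriv_schlafliY ν hx, h0]
  simpa using schlafliY_succ_ne_zero_of_eq_zero hν hx h0

theorem strictMonoOn_schlafliY {ν a b : ℝ} (ha : 0 ≤ a)
    (h : ∀ x ∈ Set.Ioo a b, 0 < deriv (schlafliY ν) x) :
    StrictMonoOn (schlafliY ν) (Set.Ioc a b) := by
  refine strictMonoOn_of_deriv_pos (convex_Ioc a b)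
    ((continuousOn_schlafliY ν).mono fun x hx => ha.trans_lt hx.1) ?_
  rwa [interior_Ioc]

/-- `Y_μ` is increasing on `(0, μ]`. -/
theorem deriv_schlafliY_pos {μ : ℝ} (hμ : 0 < μ) {x : ℝ} (hx : 0 < x) (hxμ : x ≤ μ) :
    0 < deriv (schlafliY μ) x := by
  have hself := deriv_schlafliY_self_pos hμ
  obtain ⟨δ, hδ, hneg⟩ := schlafliY_neg_and_deriv_pos_near_zero hμ.le
  by_cases hY : ∀ t, 0 < t → t < μ → schlafliY μ t < 0
  · have h := antitoneOn_mul_deriv_schlafliY (ν := μ) (b := μ) hx fun t ht =>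
      mul_nonpos_of_nonneg_of_nonpos (by nlinarith [ht.1, ht.2]) (hY t (hx.trans ht.1) ht.2).le
    have := h (Set.left_mem_Icc.2 hxμ) (Set.right_mem_Icc.2 hxμ) hxμ
    exact pos_of_mul_pos_right ((mul_pos hμ hself).trans_le this) hx.le
  push Not at hY
  obtain ⟨c, hc0, hcμ, hc⟩ := hY
  obtain ⟨z, hz0, hzc, hz, hzt⟩ := exists_first_pos_zero (continuousOn_schlafliY μ).neg hδ
    (fun t h0 h1 => neg_pos.2 (hneg t h0 h1).1) hc0 (neg_nonpos.2 hc)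
  rw [Pi.neg_apply, neg_eq_zero] at hz
  have hzd : 0 < deriv (schlafliY μ) z := by
    refine lt_of_le_of_ne ?_ (deriv_schlafliY_ne_zero_of_eq_zero hμ.le hz0 hz).symm
    exact neg_nonpos.1 ((hasDerivAt_schlafliY μ hz0).neg.nonpos_of_nonneg_left hz0 (by simp [hz])
      fun t ht => (hzt t ht.1 ht.2).le)
  rcases le_or_gt x z with hxz | hzx
  · have h := antitoneOn_mul_deriv_schlafliY (ν := μ) (b := z) hx fun t ht =>
      mul_nonpos_of_nonneg_of_nonpos (by nlinarith [ht.1, ht.2])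
        (neg_pos.1 (hzt t (hx.trans ht.1) ht.2)).le
    have := h (Set.left_mem_Icc.2 hxz) (Set.right_mem_Icc.2 hxz) hxz
    exact pos_of_mul_pos_right ((mul_pos hz0 hzd).trans_le this) hx.le
  by_contra! hxn
  obtain ⟨y, hy, hy0, hyt⟩ := exists_first_zero hzx.le ((continuousOn_deriv_schlafliY μ).mono
    fun t ht => hz0.trans_le ht.1) hzd hxn
  have hmono : MonotoneOn (schlafliY μ) (Set.Icc z y) := by
    refine monotoneOn_of_deriv_nonneg (convex_Icc z y)
      ((continuousOn_schlafliY μ).mono fun t ht => hz0.trans_le ht.1)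
      (fun t ht => ?_) fun t ht => ?_
    · rw [interior_Icc] at ht
      exact (hasDerivAt_schlafliY μ (hz0.trans ht.1)).differentiableAt.differentiableWithinAt
    · rw [interior_Icc] at ht
      exact (hyt t ⟨ht.1.le, ht.2⟩).le
  have h := monotoneOn_mul_deriv_schlafliY (ν := μ) (b := y) hz0 fun t ht => by
    have h1 := hmono (Set.left_mem_Icc.2 hy.1.le) (Set.Ioo_subset_Icc_self ht) ht.1.le
    exact mul_nonneg (by nlinarith [ht.1, ht.2, hy.2]) (hz ▸ h1)
  have h2 := h (Set.left_mem_Icc.2 hy.1.le) (Set.right_mem_Icc.2 hy.1.le) hy.1.le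
  simp only [hy0, mul_zero] at h2
  exact (mul_pos hz0 hzd).not_ge h2

theorem lt_of_deriv_schlafliY_eq_zero {μ : ℝ} (hμ : 0 < μ) {x : ℝ} (hx : 0 < x)
    (h : deriv (schlafliY μ) x = 0) : μ < x := by
  by_contra! hle
  exact (deriv_schlafliY_pos hμ hx hle).ne' h

theorem schlafliY_succ_of_deriv_eq_zero {ν x : ℝ} (hx : 0 < x)
    (h : deriv (schlafliY ν) x = 0) : schlafliY (ν + 1) x = ν / x * schlafliY ν x := by
  rw [deriv_schlafliY ν hx] at h
  linarith

theorem deriv_succ_of_deriv_eq_zero {ν x : ℝ} (hx : 0 < x) (h : deriv (schlafliY ν) x = 0) :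
    deriv (schlafliY (ν + 1)) x = (1 - ν * (ν + 1) / x ^ 2) * schlafliY ν x := by
  rw [deriv_schlafliY_succ ν hx, schlafliY_succ_of_deriv_eq_zero hx h]
  field_simp

theorem lt_sq_of_deriv_schlafliY_eq_zero {ν : ℝ} (hν : 0 ≤ ν) {x : ℝ} (hx : 0 < x)
    (h : deriv (schlafliY ν) x = 0) : ν * (ν + 1) < x ^ 2 := by
  by_contra! hle
  obtain ⟨δ, hδ, hnear⟩ := schlafliY_neg_and_deriv_pos_near_zero hν
  obtain ⟨z, hz0, hzx, hz, hzt⟩ := exists_first_pos_zero (continuousOn_deriv_schlafliY ν) hδ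
    (fun t h0 h1 => (hnear t h0 h1).2) hx h.le
  have hz2 : z ^ 2 ≤ ν * (ν + 1) := (by gcongr : z ^ 2 ≤ x ^ 2).trans hle
  have hν0 : 0 < ν := hν.lt_of_ne fun h0 => by
    rw [← h0, zero_mul] at hz2
    exact (sq_pos_of_pos hz0).not_ge hz2
  have hzν : z ≤ ν + 1 := by nlinarith
  have hw := deriv_schlafliY_pos (by linarith : 0 < ν + 1) hz0 hzν
  rw [deriv_succ_of_deriv_eq_zero hz0 hz] at hw
  have hfac : 1 - ν * (ν + 1) / z ^ 2 ≤ 0 := by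
    rw [sub_nonpos, le_div_iff₀ (by positivity)]
    linarith
  have hYz : schlafliY ν z < 0 := by
    by_contra! hY
    exact (mul_nonpos_of_nonpos_of_nonneg hfac hY).not_gt hw
  have hνz := lt_of_deriv_schlafliY_eq_zero hν0 hz0 hz
  have hmono := strictMonoOn_schlafliY (ν := ν) (b := z) le_rfl fun t ht => hzt t ht.1 ht.2
  have h1 := monotoneOn_mul_deriv_schlafliY (ν := ν) (b := z) hν0 fun t ht => by
    have h0 := hν0.trans ht.1
    have hY := hmono ⟨h0, ht.2.le⟩ (Set.right_mem_Ioc.2 hz0) ht.2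
    exact mul_nonneg_of_nonpos_of_nonpos (by nlinarith [ht.1]) (hY.trans hYz).le
  have h2 := h1 (Set.left_mem_Icc.2 hνz.le) (Set.right_mem_Icc.2 hνz.le) hνz.le
  simp only [hz, mul_zero] at h2
  exact (mul_pos hν0 (deriv_schlafliY_self_pos hν0)).not_ge h2

theorem deriv_deriv_schlafliY_mul_neg {ν : ℝ} (hν : 0 ≤ ν) {x : ℝ} (hx : 0 < x)
    (h : deriv (schlafliY ν) x = 0) :
    deriv (deriv (schlafliY ν)) x * deriv (schlafliY (ν + 1)) x < 0 := by
  have hY : schlafliY ν x ≠ 0 := fun h0 => deriv_schlafliY_ne_zero_of_eq_zero hν hx h0 h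
  have hfac : 0 < 1 - ν * (ν + 1) / x ^ 2 := by
    rw [sub_pos, div_lt_one (by positivity)]
    exact lt_sq_of_deriv_schlafliY_eq_zero hν hx h
  have hY2 := sq_pos_of_ne_zero hY
  have hk : 0 ≤ ν / x ^ 2 := by positivity
  rw [(hasDerivAt_deriv_schlafliY ν hx).deriv, h, deriv_succ_of_deriv_eq_zero hx h]
  generalize 1 - ν * (ν + 1) / x ^ 2 = k at hfac
  have : 0 < (ν / x ^ 2 + k) * k * schlafliY ν x ^ 2 := by positivity
  linarith

theorem deriv_deriv_schlafliY_succ_mul_pos {ν : ℝ} (hν : 0 ≤ ν) {x : ℝ} (hx : 0 < x)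
    (h : deriv (schlafliY (ν + 1)) x = 0) :
    0 < deriv (deriv (schlafliY (ν + 1))) x * deriv (schlafliY ν) x := by
  have hZ : schlafliY (ν + 1) x ≠ 0 := fun h0 =>
    deriv_schlafliY_ne_zero_of_eq_zero (by linarith) hx h0 h
  have hY : schlafliY ν x = (ν + 1) / x * schlafliY (ν + 1) x := by
    rw [deriv_schlafliY_succ ν hx] at h
    linarith
  have hlt := lt_of_deriv_schlafliY_eq_zero (by linarith : 0 < ν + 1) hx h
  have hu : deriv (schlafliY ν) x = (ν * (ν + 1) / x ^ 2 - 1) * schlafliY (ν + 1) x := by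
    rw [deriv_schlafliY ν hx, hY]
    field_simp
  rw [(hasDerivAt_deriv_schlafliY_succ ν hx).deriv, h, hu]
  have h1 : ν * (ν + 1) / x ^ 2 - 1 < 0 := by
    rw [sub_neg, div_lt_one (by positivity)]
    nlinarith
  have h2 : (ν * (ν + 1) / x ^ 2 - 1) + (ν + 1) / x ^ 2 < 0 := by
    have : (ν * (ν + 1) / x ^ 2 - 1) + (ν + 1) / x ^ 2 = (ν + 1) ^ 2 / x ^ 2 - 1 := by ring
    rw [this, sub_neg, div_lt_one (by positivity)]
    nlinarith
  have hZ2 := sq_pos_of_ne_zero hZ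
  have := mul_pos (mul_pos_of_neg_of_neg h1 h2) hZ2
  linarith

theorem exists_deriv_schlafliY_eq_zero_lt {ν : ℝ} (hν : 0 ≤ ν) {b : ℝ} (hb : 0 < b)
    (hb0 : deriv (schlafliY (ν + 1)) b = 0)
    (hfirst : ∀ x ∈ Set.Ioo 0 b, deriv (schlafliY (ν + 1)) x ≠ 0) :
    ∃ a, 0 < a ∧ a < b ∧ deriv (schlafliY ν) a = 0 := by
  have hlt := lt_of_deriv_schlafliY_eq_zero (by linarith : 0 < ν + 1) hb hb0
  have hpos : ∀ x ∈ Set.Ioo 0 b, 0 < deriv (schlafliY (ν + 1)) x := by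
    refine (forall_pos_or_forall_neg_of_ne_zero isPreconnected_Ioo
      ((continuousOn_deriv_schlafliY (ν + 1)).mono fun x hx => hx.1) hfirst).resolve_right
      fun h => ?_
    exact (h (ν + 1) ⟨by linarith, hlt⟩).not_gt (deriv_schlafliY_self_pos (by linarith))
  have hd := (hasDerivAt_deriv_schlafliY (ν + 1) hb).differentiableAt.hasDerivAt
  have hq := hd.nonpos_of_nonneg_left hb hb0 fun x hx => (hpos x hx).le
  have hu : deriv (schlafliY ν) b < 0 := by
    by_contra! hu
    exact (mul_nonpos_of_nonpos_of_nonneg hq hu).not_gt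
      (deriv_deriv_schlafliY_succ_mul_pos hν hb hb0)
  obtain ⟨δ, hδ, hnear⟩ := schlafliY_neg_and_deriv_pos_near_zero hν
  obtain ⟨z, hz0, hzb, hz, -⟩ := exists_first_pos_zero (continuousOn_deriv_schlafliY ν) hδ
    (fun t h0 h1 => (hnear t h0 h1).2) hb hu.le
  exact ⟨z, hz0, hzb.lt_of_ne fun h => hu.ne (h ▸ hz), hz⟩

theorem deriv_besselY_eq_deriv_schlafliY (ν : ℝ) {x : ℝ} (hx : 0 < x) :
    deriv (besselY ν) x = deriv (schlafliY ν) x := by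
  refine Filter.EventuallyEq.deriv_eq ?_
  filter_upwards [Ioi_mem_nhds hx] with t ht
  exact besselY_eq_schlafliY ν ht

end DerivZeros

/-- Interlacing of the positive zeros of `Y'_ν` and `Y'_{ν+1}`:
`y'_{ν,s} < y'_{ν+1,s} < y'_{ν,s+1}` for all `s ≥ 1`. -/
theorem besselYDeriv_zeros_interlace (ν : ℝ) (hν : 0 ≤ ν)
    (y' y1' : ℕ → ℝ)
    (hy' : IsPosZeroSeq (deriv (besselY ν)) y')
    (hy1' : IsPosZeroSeq (deriv (besselY (ν + 1))) y1') :
    ∀ s : ℕ, 1 ≤ s → y' s < y1' s ∧ y1' s < y' (s + 1) := by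
  have ha := hy'.congr fun x hx => deriv_besselY_eq_deriv_schlafliY ν hx
  have hb := hy1'.congr fun x hx => deriv_besselY_eq_deriv_schlafliY (ν + 1) hx
  have hd : ∀ (μ : ℝ) {x : ℝ}, 0 < x →
      HasDerivAt (deriv (schlafliY μ)) (deriv (deriv (schlafliY μ)) x) x := fun μ x hx =>
    (hasDerivAt_deriv_schlafliY μ hx).differentiableAt.hasDerivAt
  refine ha.interlace hb ?_ (fun s hs => ?_) fun s hs => ?_
  · obtain ⟨z, hz0, hzb, hz⟩ := exists_deriv_schlafliY_eq_zero_lt hν (hb.pos 1 le_rfl)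
      (hb.isZero 1 le_rfl) fun x hx h0 => (hb.one_le hx.1 h0).not_gt hx.2
    exact (ha.one_le hz0 hz).trans_lt hzb
  · have h0 := ha.pos s hs
    have h1 := ha.pos (s + 1) (by omega)
    exact exists_zero_between_zeros (ha.mono s (s + 1) hs (by omega))
      ((continuousOn_deriv_schlafliY ν).mono fun x hx => h0.trans_le hx.1)
      ((continuousOn_deriv_schlafliY (ν + 1)).mono fun x hx => h0.trans_le hx.1)
      (hd ν h0) (hd ν h1) (ha.isZero s hs) (ha.isZero (s + 1) (by omega))
      (fun x hx => ha.ne_zero_of_mem_Ioo hs hx)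
      (mul_pos_of_neg_of_neg (deriv_deriv_schlafliY_mul_neg hν h0 (ha.isZero s hs))
        (deriv_deriv_schlafliY_mul_neg hν h1 (ha.isZero (s + 1) (by omega))))
  · have h0 := hb.pos s hs
    have h1 := hb.pos (s + 1) (by omega)
    exact exists_zero_between_zeros (hb.mono s (s + 1) hs (by omega))
      ((continuousOn_deriv_schlafliY (ν + 1)).mono fun x hx => h0.trans_le hx.1)
      ((continuousOn_deriv_schlafliY ν).mono fun x hx => h0.trans_le hx.1)
      (hd (ν + 1) h0) (hd (ν + 1) h1) (hb.isZero s hs) (hb.isZero (s + 1) (by omega))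
      (fun x hx => hb.ne_zero_of_mem_Ioo hs hx)
      (mul_pos (deriv_deriv_schlafliY_succ_mul_pos hν h0 (hb.isZero s hs))
        (deriv_deriv_schlafliY_succ_mul_pos hν h1 (hb.isZero (s + 1) (by omega))))
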